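/- Let G be a finite simple robust graph with no reducible vertex set. Then every vertex of degree 9 in G subsumes at most three vertices of degree at most 6; furthermore, if a vertex of degree 9 subsumes exactly three vertices of degree at most 6, then it has no other neighbor of degree at most 6. -/

import Mathlib

open SimpleGraph

variable {V : Type*}

/-- `S` is a set of pairwise edge-disjoint triangles of `G` (two triangles, viewed as
3-element vertex sets, are edge-disjoint iff they share at most one vertex). -/
def EdgeDisjointTriangles [DecidableEq V] (G : SimpleGraph V) (S : Finset (Finset V)) : Prop :=
  (∀ t ∈ S, G.IsNClique 3 t) ∧
    ∀ t₁ ∈ S, ∀ t₂ ∈ S, t₁ ≠ t₂ → (t₁ ∩ t₂).card ≤ 1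

/-- `G` is robust: for every vertex `v`, every connected component of the subgraph induced
by the neighborhood of `v` has at least 5 vertices. -/
def Robust (G : SimpleGraph V) : Prop :=
  ∀ (v : V) (c : (G.induce (G.neighborSet v)).ConnectedComponent), 5 ≤ c.supp.ncard

/-- `V₀` is a reducible vertex set of `G`. -/
def ReducibleVertexSet [DecidableEq V] (G : SimpleGraph V) (V₀ : Finset V) : Prop :=
  V₀.Nonempty ∧
    ∃ (S : Finset (Finset V)) (X : Finset (Sym2 V)),
      EdgeDisjointTriangles G S ∧ ↑X ⊆ G.edgeSet ∧ X.card ≤ 2 * S.card ∧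
      (∀ t : Finset V, (G.deleteEdges ↑X).IsNClique 3 t → ∀ x ∈ V₀, x ∉ t) ∧
      (∀ t ∈ S, ∀ u ∈ t, ∀ v ∈ t, u ≠ v → u ∉ V₀ → v ∉ V₀ → s(u, v) ∈ X)

namespace NV

lemma red_core [DecidableEq V] {G : SimpleGraph V}
    (hnored : ¬ ∃ V₀ : Finset V, ReducibleVertexSet G V₀)
    (V₀ : Finset V) (hne : V₀.Nonempty) (S : Finset (Finset V)) (X : Finset (Sym2 V))
    (hS : EdgeDisjointTriangles G S) (hX : X.card ≤ 2 * S.card)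
    (hcov : ∀ w ∈ V₀, ∀ a b, G.Adj w a → G.Adj w b → G.Adj a b →
      s(w, a) ∈ X ∨ s(w, b) ∈ X ∨ s(a, b) ∈ X)
    (hSX : ∀ t ∈ S, ∀ u ∈ t, ∀ v ∈ t, u ≠ v → u ∉ V₀ → v ∉ V₀ → s(u, v) ∈ X) : False := by
  classical
  refine hnored ⟨V₀, hne, S, X.filter (· ∈ G.edgeSet), hS, ?_, ?_, ?_, ?_⟩
  · intro e he
    simp only [Finset.coe_filter, Set.mem_ofPred_eq] at he
    exact he.2
  · exact (Finset.card_filter_le _ _).trans hX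
  · intro t ht x hx hxt
    obtain ⟨hc, h3⟩ := ht
    have h2 : (t.erase x).card = 2 := by rw [Finset.card_erase_of_mem hxt, h3]
    obtain ⟨a, b, hab, he⟩ := Finset.card_eq_two.1 h2
    have ha : a ∈ t.erase x := by rw [he]; simp
    have hb : b ∈ t.erase x := by rw [he]; simp
    simp only [Finset.mem_erase] at ha hb
    have h1 := hc hxt ha.2 (Ne.symm ha.1)
    have h2' := hc hxt hb.2 (Ne.symm hb.1)
    have h3' := hc ha.2 hb.2 hab
    simp only [SimpleGraph.deleteEdges_adj, Finset.coe_filter, Set.mem_ofPred_eq,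
      SimpleGraph.mem_edgeSet, not_and] at h1 h2' h3'
    rcases hcov x hx a b h1.1 h2'.1 h3'.1 with h | h | h
    · exact h1.2 h h1.1
    · exact h2'.2 h h2'.1
    · exact h3'.2 h h3'.1
  · intro t ht u hu v hv huv h1 h2
    rw [Finset.mem_filter]
    exact ⟨hSX t ht u hu v hv huv h1 h2, (hS.1 t ht).1 hu hv huv⟩

lemma red_fam [DecidableEq V] {G : SimpleGraph V}
    (hnored : ¬ ∃ V₀ : Finset V, ReducibleVertexSet G V₀)
    {ι : Type*} [Fintype ι] (T : ι → Finset V) (hT : ∀ i, G.IsNClique 3 (T i))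
    (hd : ∀ i j, i ≠ j → (T i ∩ T j).card ≤ 1)
    (V₀ : Finset V) (hne : V₀.Nonempty) (X : Finset (Sym2 V))
    (hX : X.card ≤ 2 * Fintype.card ι)
    (hcov : ∀ w ∈ V₀, ∀ a b, G.Adj w a → G.Adj w b → G.Adj a b →
      s(w, a) ∈ X ∨ s(w, b) ∈ X ∨ s(a, b) ∈ X)
    (hSX : ∀ i, ∀ u ∈ T i, ∀ v ∈ T i, u ≠ v → u ∉ V₀ → v ∉ V₀ → s(u, v) ∈ X) : False := by
  classical
  have hinj : Function.Injective T := by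
    intro i j hij
    by_contra hne'
    have := hd i j hne'
    rw [hij, Finset.inter_self, (hT j).2] at this
    omega
  refine red_core hnored V₀ hne (Finset.univ.image T) X ⟨?_, ?_⟩ ?_ hcov ?_
  · intro t ht
    obtain ⟨i, -, rfl⟩ := Finset.mem_image.1 ht
    exact hT i
  · intro t₁ h₁ t₂ h₂ h12
    obtain ⟨i, -, rfl⟩ := Finset.mem_image.1 h₁
    obtain ⟨j, -, rfl⟩ := Finset.mem_image.1 h₂
    exact hd i j (fun h => h12 (by rw [h]))
  · rw [Finset.card_image_of_injective _ hinj]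
    exact hX
  · intro t ht
    obtain ⟨i, -, rfl⟩ := Finset.mem_image.1 ht
    exact hSX i

def chkC1 {n : ℕ} (V₀ : List (Fin n)) (X NA : List (Fin n × Fin n)) : Prop :=
  ∀ i j k, i ∉ V₀ ∨ i = j ∨ i = k ∨ j = k ∨
    ((i, j) ∈ X ∨ (j, i) ∈ X ∨ (i, j) ∈ NA ∨ (j, i) ∈ NA) ∨
    ((i, k) ∈ X ∨ (k, i) ∈ X ∨ (i, k) ∈ NA ∨ (k, i) ∈ NA) ∨
    ((j, k) ∈ X ∨ (k, j) ∈ X ∨ (j, k) ∈ NA ∨ (k, j) ∈ NA)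

set_option synthInstance.maxSize 10000 in
set_option synthInstance.maxHeartbeats 1000000 in
instance {n : ℕ} (V₀ : List (Fin n)) (X NA : List (Fin n × Fin n)) :
    Decidable (chkC1 V₀ X NA) := by unfold chkC1; infer_instance

def tri {n : ℕ} (t : Fin n × Fin n × Fin n) : Finset (Fin n) := {t.1, t.2.1, t.2.2}

def chkC2 {n s : ℕ} (V₀ : List (Fin n)) (S : Fin s → Fin n × Fin n × Fin n)
    (X : List (Fin n × Fin n)) : Prop :=
  (∀ i j, i = j ∨ (tri (S i) ∩ tri (S j)).card ≤ 1) ∧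
  ∀ i, ∀ a b, a ∉ tri (S i) ∨ b ∉ tri (S i) ∨ a = b ∨ a ∈ V₀ ∨ b ∈ V₀ ∨ (a, b) ∈ X ∨ (b, a) ∈ X

set_option synthInstance.maxSize 10000 in
set_option synthInstance.maxHeartbeats 1000000 in
instance {n s : ℕ} (V₀ : List (Fin n)) (S : Fin s → Fin n × Fin n × Fin n)
    (X : List (Fin n × Fin n)) : Decidable (chkC2 V₀ S X) := by unfold chkC2; infer_instance

lemma red_fin [DecidableEq V] {G : SimpleGraph V}
    (hnored : ¬ ∃ V₀ : Finset V, ReducibleVertexSet G V₀)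
    {n s : ℕ} (f : Fin n → V) (hf : (List.ofFn f).Nodup) (V₀ : List (Fin n)) (hne : V₀ ≠ [])
    (S : Fin s → Fin n × Fin n × Fin n) (X NA : List (Fin n × Fin n)) (ext : List (Fin n))
    (o : Fin n → V)
    (h1 : X.length + ext.length ≤ 2 * s)
    (h2 : chkC1 V₀ X NA) (h3 : chkC2 V₀ S X)
    (hN : ∀ i ∈ V₀, ∀ u, G.Adj (f i) u → (∃ j, f j = u) ∨ (i ∈ ext ∧ u = o i))
    (hS : ∀ i, G.Adj (f (S i).1) (f (S i).2.1) ∧ G.Adj (f (S i).1) (f (S i).2.2) ∧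
      G.Adj (f (S i).2.1) (f (S i).2.2))
    (hNA : ∀ p ∈ NA, ¬ G.Adj (f p.1) (f p.2)) : False := by
  classical
  have hinj : Function.Injective f := List.nodup_ofFn.1 hf
  have hmemX : ∀ a b, (a, b) ∈ X ∨ (b, a) ∈ X → s(f a, f b) ∈
      (X.map (fun p => s(f p.1, f p.2))).toFinset ∪ (ext.map (fun i => s(f i, o i))).toFinset := by
    intro a b h
    rw [Finset.mem_union]
    left
    rw [List.mem_toFinset, List.mem_map]
    rcases h with h | h
    · exact ⟨_, h, rfl⟩
    · exact ⟨_, h, Sym2.eq_swap⟩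
  have hNA' : ∀ a b, G.Adj (f a) (f b) → (a, b) ∈ X ∨ (b, a) ∈ X ∨ (a, b) ∈ NA ∨ (b, a) ∈ NA →
      (a, b) ∈ X ∨ (b, a) ∈ X := by
    intro a b hab h
    rcases h with h | h | h | h
    · exact Or.inl h
    · exact Or.inr h
    · exact absurd hab (hNA _ h)
    · exact absurd hab.symm (hNA _ h)
  have himg : ∀ i, (tri (S i)).image f = {f (S i).1, f (S i).2.1, f (S i).2.2} := by
    intro i; simp [tri, Finset.image_insert]
  refine red_fam hnored (fun i : Fin s => (tri (S i)).image f) ?_ ?_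
    (V₀.toFinset.image f) ?_ ((X.map (fun p => s(f p.1, f p.2))).toFinset ∪
      (ext.map (fun i => s(f i, o i))).toFinset) ?_ ?_ ?_
  · intro i
    rw [himg]
    obtain ⟨ha, hb, hc⟩ := hS i
    exact SimpleGraph.is3Clique_iff.2 ⟨_, _, _, ha, hb, hc, rfl⟩
  · intro i j hij
    rw [← Finset.image_inter _ _ hinj]
    exact Finset.card_image_le.trans ((h3.1 i j).resolve_left hij)
  · rw [Finset.image_nonempty, List.toFinset_nonempty_iff]
    exact hne
  · rw [Fintype.card_fin]
    refine (Finset.card_union_le _ _).trans ((Nat.add_le_add (List.toFinset_card_le _)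
      (List.toFinset_card_le _)).trans ?_)
    simpa using h1
  · intro w hw a b ha hb hab
    obtain ⟨i, hi, rfl⟩ := Finset.mem_image.1 hw
    rw [List.mem_toFinset] at hi
    rcases hN i hi a ha with ⟨j, rfl⟩ | ⟨he, rfl⟩
    · rcases hN i hi b hb with ⟨k, rfl⟩ | ⟨he, rfl⟩
      · rcases h2 i j k with h | h | h | h | h | h | h
        · exact absurd hi h
        · exact absurd (by rw [h]) ha.ne
        · exact absurd (by rw [h]) hb.ne
        · exact absurd (by rw [h]) hab.ne
        · exact Or.inl (hmemX _ _ (hNA' _ _ ha h))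
        · exact Or.inr (Or.inl (hmemX _ _ (hNA' _ _ hb h)))
        · exact Or.inr (Or.inr (hmemX _ _ (hNA' _ _ hab h)))
      · right; left
        rw [Finset.mem_union, List.mem_toFinset, List.mem_toFinset, List.mem_map, List.mem_map]
        exact Or.inr ⟨i, he, rfl⟩
    · left
      rw [Finset.mem_union, List.mem_toFinset, List.mem_toFinset, List.mem_map, List.mem_map]
      exact Or.inr ⟨i, he, rfl⟩
  · intro i a ha b hb hab hna hnb
    obtain ⟨a, ha', rfl⟩ := Finset.mem_image.1 ha
    obtain ⟨b, hb', rfl⟩ := Finset.mem_image.1 hb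
    apply hmemX
    rcases h3.2 i a b with h | h | h | h | h | h
    · exact absurd ha' h
    · exact absurd hb' h
    · exact absurd (by rw [h]) hab
    · exact absurd (Finset.mem_image_of_mem _ (List.mem_toFinset.2 h)) hna
    · exact absurd (Finset.mem_image_of_mem _ (List.mem_toFinset.2 h)) hnb
    · exact h

/-- cut form of robustness -/
lemma cut [Finite V] {G : SimpleGraph V} (hrob : Robust G) (w : V) (A : Set V) (a : V)
    (ha : a ∈ A) (hwa : G.Adj w a)
    (hcl : ∀ x ∈ A, ∀ y, G.Adj w x → G.Adj w y → G.Adj x y → y ∈ A) : 5 ≤ A.ncard := by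
  let H := G.induce (G.neighborSet w)
  have h5 := hrob w (H.connectedComponentMk ⟨a, hwa⟩)
  have hsub : (Subtype.val '' (H.connectedComponentMk ⟨a, hwa⟩).supp) ⊆ A := by
    rintro _ ⟨x, hx, rfl⟩
    rw [SimpleGraph.ConnectedComponent.mem_supp_iff, SimpleGraph.ConnectedComponent.eq] at hx
    obtain ⟨p⟩ := hx.symm
    have : ∀ (x y : G.neighborSet w), H.Walk x y → x.1 ∈ A → y.1 ∈ A := by
      intro x y p
      induction p with
      | nil => exact id
      | @cons x y z h _ ih => 
        intro hx
        exact ih (hcl x.1 hx y.1 x.2 y.2 h)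
    exact this _ _ p ha
  have := Set.ncard_le_ncard hsub (Set.toFinite _)
  rw [Set.ncard_image_of_injective _ Subtype.val_injective] at this
  omega

lemma deg5 [Finite V] [DecidableEq V] {G : SimpleGraph V} (hrob : Robust G)
    (hnored : ¬ ∃ V₀ : Finset V, ReducibleVertexSet G V₀) (w : V) :
    5 ≤ (G.neighborSet w).ncard := by
  by_cases h : ∃ a, G.Adj w a
  · obtain ⟨a, ha⟩ := h
    exact cut hrob w _ a ha ha (fun x _ y _ hy _ => hy)
  · exfalso
    push Not at h
    refine red_core hnored {w} (by simp) ∅ ∅ ⟨by simp, by simp⟩ (by simp) ?_ (by simp)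
    intro x hx a b ha
    rw [Finset.mem_singleton] at hx
    subst hx
    exact absurd ha (h a)

/-! ### Neighbourhoods of vertices of degree at most six -/

def enum : List ℕ → ℕ → (ℕ → Bool) → Bool
  | [], m, k => k m
  | b :: bs, m, k => enum bs m k && enum bs (Nat.lor m (2 ^ b)) k

def build (g : ℕ → Bool) : List ℕ → ℕ → ℕ
  | [], m => m
  | b :: bs, m => build g bs (if g b then Nat.lor m (2 ^ b) else m)

lemma enum_build (g : ℕ → Bool) (k : ℕ → Bool) : ∀ (bs : List ℕ) (m : ℕ), enum bs m k = true →
    k (build g bs m) = true := by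
  intro bs
  induction bs with
  | nil => intro m h; exact h
  | cons b bs ih =>
    intro m h
    simp only [enum, Bool.and_eq_true] at h
    simp only [build]
    split
    · exact ih _ h.2
    · exact ih _ h.1

lemma testBit_build (g : ℕ → Bool) (j : ℕ) : ∀ (bs : List ℕ) (m : ℕ),
    (build g bs m).testBit j = (m.testBit j || (decide (j ∈ bs) && g j)) := by
  intro bs
  induction bs with
  | nil => intro m; simp [build]
  | cons b bs ih =>
    intro m
    simp only [build]
    rw [ih]
    have hl : ∀ a c : ℕ, Nat.lor a c = a ||| c := fun _ _ => rfl
    by_cases hb : g b = true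
    · rw [if_pos hb, hl, Nat.testBit_or, Nat.testBit_two_pow]
      by_cases hj : b = j
      · subst hj; simp [hb]
      · have : ¬ j = b := fun h => hj h.symm
        simp [hj, this]
    · rw [if_neg hb]
      by_cases hj : j = b
      · subst hj; simp [hb]
      · simp [hj]

def pairMask : List (Fin 6 × Fin 6) → ℕ
  | [] => 0
  | p :: ps => 2 ^ (6 * p.1.val + p.2.val) ||| pairMask ps

lemma testBit_pairMask (a b : Fin 6) : ∀ L : List (Fin 6 × Fin 6),
    (pairMask L).testBit (6 * a.val + b.val) = true ↔ (a, b) ∈ L := by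
  intro L
  induction L with
  | nil => simp [pairMask]
  | cons p ps ih =>
    obtain ⟨c, d⟩ := p
    rw [pairMask, Nat.testBit_or, Nat.testBit_two_pow, Bool.or_eq_true, ih, List.mem_cons,
      decide_eq_true_eq, Prod.mk.injEq]
    have : 6 * c.val + d.val = 6 * a.val + b.val ↔ a = c ∧ b = d := by
      constructor
      · intro h
        constructor <;> ext <;> omega
      · rintro ⟨rfl, rfl⟩; rfl
    rw [this]

def allPairs : List (Fin 6 × Fin 6) :=
  [(0, 1), (0, 2), (0, 3), (0, 4), (0, 5), (1, 2), (1, 3), (1, 4), (1, 5), (2, 3), (2, 4), (2, 5),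
    (3, 4), (3, 5), (4, 5)]

lemma mem_allPairs : ∀ i j : Fin 6, i < j → (i, j) ∈ allPairs := by decide

def compile (c : List (Fin 6 × Fin 6) × List (Fin 6)) : ℕ × ℕ :=
  (pairMask c.1, pairMask c.1 |||
    pairMask (allPairs.filter fun p => decide (p.1 ∈ c.2) || decide (p.2 ∈ c.2)))

def cutMask (A : List (Fin 6)) : ℕ :=
  pairMask (allPairs.filter fun p => decide (p.1 ∈ A) != decide (p.2 ∈ A))

def certs5 : List (List (Fin 6 × Fin 6) × List (Fin 6)) := [
  ([(0, 1), (2, 3)], [3, 4]), ([(0, 1), (2, 4)], [3, 4]), ([(0, 3), (1, 4)], [3, 4]),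
  ([(0, 4), (1, 3)], [3, 4]), ([(2, 3)], [4]), ([(2, 4)], [3]), ([(0, 3)], [3]), ([(0, 4)], [4])]

def masks5 : List (ℕ × ℕ) := [
  (32770, 549553690), (65538, 549553690), (1032, 549553688), (528, 549553688),
  (32768, 541164560), (65536, 12681736), (8, 12616200), (16, 541131792)]

def cuts5 : List (List (Fin 6)) := [
  [0], [1], [2], [3], [4], [0, 1], [0, 2], [0, 3], [0, 4], [1, 2], [1, 3], [1, 4], [2, 3],
  [2, 4], [3, 4]]

def cmasks5 : List ℕ := [
  62, 3842, 229636, 12616200, 541131792, 3900, 229690, 12616246, 541131822, 232966, 12619018,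
  541133586, 12780300, 541230356, 545359384]

def bits5 : List ℕ := [1, 3, 4, 9, 10, 15, 16, 22]

def certs6 : List (List (Fin 6 × Fin 6) × List (Fin 6)) := [
  ([(0, 1), (2, 3), (4, 5)], [3, 4, 5]), ([(0, 1), (2, 4), (3, 5)], [3, 4, 5]),
  ([(0, 1), (2, 5), (3, 4)], [3, 4, 5]), ([(0, 3), (1, 4), (2, 5)], [3, 4, 5]),
  ([(0, 4), (1, 5), (2, 3)], [3, 4, 5]), ([(0, 5), (1, 3), (2, 4)], [3, 4, 5]),
  ([(0, 3), (1, 5), (2, 4)], [0, 3, 4]), ([(0, 4), (1, 3), (2, 5)], [0, 4, 5]),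
  ([(0, 5), (1, 4), (2, 3)], [0, 3, 5]), ([(0, 3), (1, 5), (2, 4)], [0, 3, 5]),
  ([(0, 4), (1, 3), (2, 5)], [0, 3, 4]), ([(0, 5), (1, 4), (2, 3)], [0, 4, 5]),
  ([(0, 3), (1, 4), (2, 5)], [1, 4, 5]), ([(0, 4), (1, 5), (2, 3)], [1, 3, 5]),
  ([(0, 5), (1, 3), (2, 4)], [1, 3, 4]), ([(0, 3), (1, 4)], [3, 4]), ([(0, 3), (1, 5)], [3, 5]),
  ([(0, 4), (1, 5)], [4, 5]), ([(0, 4), (1, 3)], [3, 4]), ([(0, 5), (1, 3)], [3, 5]),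
  ([(0, 5), (1, 4)], [4, 5]), ([(0, 1), (2, 3)], [4, 5]), ([(0, 1), (2, 4)], [3, 5]),
  ([(0, 1), (2, 5)], [0, 5]), ([(2, 3), (4, 5)], [4, 5]), ([(0, 1), (2, 5)], [1, 5]),
  ([(0, 1), (2, 3)], [0, 3]), ([(0, 1), (2, 4)], [0, 4]), ([(2, 4), (3, 5)], [3, 5]),
  ([(1, 3), (2, 4)], [1, 4]), ([(1, 4), (2, 3)], [1, 3]), ([(2, 5), (3, 4)], [3, 4]),
  ([(0, 1), (2, 5)], [3, 4]), ([(0, 3), (4, 5)], [4, 5]), ([(0, 4), (1, 3)], [3, 5]),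
  ([(0, 5), (1, 3)], [4, 5]), ([(1, 5), (2, 3)], [0, 3]), ([(1, 5), (2, 4)], [0, 4]),
  ([(0, 3), (4, 5)], [1, 3]), ([(0, 4), (3, 5)], [1, 4]), ([(0, 3), (1, 4), (2, 5)], [0, 1, 2]),
  ([(0, 5), (3, 4)], [2, 5]), ([(0, 4), (1, 5), (2, 3)], [1, 4, 5]), ([(0, 3), (2, 4)], [1, 4]),
  ([(0, 3), (2, 5)], [1, 5]), ([(0, 4), (2, 3)], [1, 3]), ([(0, 4), (2, 5)], [1, 5]),
  ([(0, 1), (2, 4)], [1, 5]), ([(0, 3), (1, 4)], [4, 5]), ([(0, 3), (1, 5)], [4, 5]),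
  ([(0, 3), (4, 5)], [2, 3]), ([(0, 4), (3, 5)], [2, 4]), ([(0, 1), (2, 5)], [1, 3]),
  ([(0, 1), (2, 3)], [0, 2]), ([(0, 5), (2, 3)], [1, 2]), ([(0, 1), (2, 3)], [1, 2]),
  ([(0, 1), (2, 4)], [0, 5]), ([(0, 3)], [3]), ([(0, 4)], [4]), ([(0, 5)], [5]),
  ([(0, 1), (2, 3)], [0, 4]), ([(0, 1), (2, 3)], [0, 5]), ([(0, 1), (2, 3)], [1, 4]),
  ([(0, 3), (2, 4)], [1, 2]), ([(0, 4), (2, 3)], [1, 2])]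

def masks6 : List (ℕ × ℕ) := [
  (536903682, 549686842), (8454146, 549686842), (4325378, 549686842), (132104, 549686840),
  (34832, 549686840), (66080, 549686840), (67592, 549555774), (131600, 549654078),
  (33824, 549621310), (67592, 549685822), (131600, 549684798), (33824, 549686334),
  (132104, 549654330), (34832, 549621562), (66080, 549556026), (1032, 549553688),
  (2056, 549620264), (2064, 549653552), (528, 549553688), (544, 549620264), (1056, 549653552),
  (32770, 549686322), (65538, 549685802), (131074, 545392702), (536903680, 549686320),
  (131074, 545394466), (32770, 12616254), (65538, 541131838), (8454144, 549685800),
  (66048, 541134610), (33792, 12619530), (4325376, 549684760), (131074, 549684762),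
  (536870920, 549653560), (528, 549620280), (544, 549654064), (34816, 12618302),
  (67584, 541133886), (536870920, 549490442), (8388624, 549523218), (132104, 233278),
  (4194336, 549685540), (34832, 549687090), (65544, 541134618), (131080, 545394474),
  (32784, 12619546), (131088, 545394482), (65538, 545460002), (1032, 549653560),
  (2056, 549653560), (536870920, 549683980), (8388624, 549684500), (131074, 12750602),
  (32770, 229694), (32800, 233254), (32770, 233222), (65538, 545458238), (8, 12616200),
  (16, 541131792), (32, 545392672), (32770, 541164606), (32770, 545425470), (32770, 541167378),
  (65544, 233230), (32784, 233238)]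

def cuts6 : List (List (Fin 6)) := [
  [0], [1], [2], [3], [4], [5], [0, 1], [0, 2], [0, 3], [0, 4], [0, 5], [1, 2], [1, 3], [1, 4],
  [1, 5], [2, 3], [2, 4], [2, 5], [3, 4], [3, 5], [4, 5], [0, 1, 2], [0, 1, 3], [0, 1, 4],
  [0, 1, 5], [0, 2, 3], [0, 2, 4], [0, 2, 5], [0, 3, 4], [0, 3, 5], [0, 4, 5]]

def cmasks6 : List ℕ := [
  62, 3842, 229636, 12616200, 541131792, 545392672, 3900, 229690, 12616246, 541131822, 545392670,
  232966, 12619018, 541133586, 545392418, 12780300, 541230356, 545360164, 545359384, 541231656,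
  12782640, 233016, 12619060, 541133612, 545392412, 12780338, 541230378, 545360154, 545359398,
  541231638, 12782606]

def bits6 : List ℕ := [1, 3, 4, 5, 9, 10, 11, 15, 16, 17, 22, 23, 29]

lemma masks5_eq : masks5 = certs5.map compile := by decide +kernel
lemma masks6_eq : masks6 = certs6.map compile := by decide +kernel
lemma cmasks5_eq : cmasks5 = cuts5.map cutMask := by decide +kernel
lemma cmasks6_eq : cmasks6 = cuts6.map cutMask := by decide +kernel

def tryCert (m : ℕ) : List (ℕ × ℕ) → Bool
  | [] => false
  | c :: cs => (Nat.beq (Nat.land m c.1) c.1 && Nat.beq (Nat.land m c.2) m) || tryCert m cs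

def tryCut (m : ℕ) : List ℕ → Bool
  | [] => false
  | c :: cs => Nat.beq (Nat.land m c) 0 || tryCut m cs

lemma of_tryCert (m : ℕ) : ∀ cs, tryCert m cs = true →
    ∃ c ∈ cs, m &&& c.1 = c.1 ∧ m &&& c.2 = m := by
  intro cs
  induction cs with
  | nil => simp [tryCert]
  | cons c cs ih =>
    intro h
    simp only [tryCert, Bool.or_eq_true, Bool.and_eq_true, Nat.beq_eq] at h
    rcases h with h | h
    · exact ⟨c, by simp, h⟩
    · obtain ⟨d, hd, h⟩ := ih h
      exact ⟨d, by simp [hd], h⟩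

lemma of_tryCut (m : ℕ) : ∀ cs, tryCut m cs = true → ∃ c ∈ cs, m &&& c = 0 := by
  intro cs
  induction cs with
  | nil => simp [tryCut]
  | cons c cs ih =>
    intro h
    simp only [tryCut, Bool.or_eq_true, Nat.beq_eq] at h
    rcases h with h | h
    · exact ⟨c, by simp, h⟩
    · obtain ⟨d, hd, h⟩ := ih h
      exact ⟨d, by simp [hd], h⟩

lemma enum5 : enum bits5 0 (fun m => tryCert m masks5 || tryCut m cmasks5) = true := by
  decide +kernel
lemma enum6 : enum bits6 0 (fun m => tryCert m masks6 || tryCut m cmasks6) = true := by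
  decide +kernel

lemma wke [DecidableEq V] {G : SimpleGraph V}
    (hnored : ¬ ∃ V₀ : Finset V, ReducibleVertexSet G V₀) (w : V)
    (f : Fin 6 → V) (hf : Function.Injective f) (hN : ∀ u, G.Adj w u → ∃ i, f i = u)
    (M : List (Fin 6 × Fin 6)) (Q : List (Fin 6)) (hQ : Q.length ≤ M.length)
    (hM : M.Pairwise (fun p q => p.1 ≠ q.1 ∧ p.1 ≠ q.2 ∧ p.2 ≠ q.1 ∧ p.2 ≠ q.2))
    (hadj : ∀ p ∈ M, G.Adj w (f p.1) ∧ G.Adj w (f p.2) ∧ G.Adj (f p.1) (f p.2))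
    (hcov : ∀ i j, G.Adj w (f i) → G.Adj w (f j) → G.Adj (f i) (f j) →
      (i, j) ∈ M ∨ (j, i) ∈ M ∨ i ∈ Q ∨ j ∈ Q) : False := by
  classical
  refine red_fam hnored (fun i : Fin M.length => ({w, f (M.get i).1, f (M.get i).2} : Finset V))
    ?_ ?_ {w} (by simp) ((M.map fun p => s(f p.1, f p.2)).toFinset ∪
      (Q.map fun q => s(w, f q)).toFinset) ?_ ?_ ?_
  · intro i
    obtain ⟨h1, h2, h3⟩ := hadj _ (M.get_mem i)
    exact SimpleGraph.is3Clique_iff.2 ⟨_, _, _, h1, h2, h3, rfl⟩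
  · intro i j hij
    have hsym : ∀ p q : Fin 6 × Fin 6, (p.1 ≠ q.1 ∧ p.1 ≠ q.2 ∧ p.2 ≠ q.1 ∧ p.2 ≠ q.2) →
        (q.1 ≠ p.1 ∧ q.1 ≠ p.2 ∧ q.2 ≠ p.1 ∧ q.2 ≠ p.2) := by
      rintro p q ⟨h1, h2, h3, h4⟩
      exact ⟨h1.symm, h3.symm, h2.symm, h4.symm⟩
    have hd : (M.get i).1 ≠ (M.get j).1 ∧ (M.get i).1 ≠ (M.get j).2 ∧ (M.get i).2 ≠ (M.get j).1 ∧
        (M.get i).2 ≠ (M.get j).2 := by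
      rcases lt_or_gt_of_ne hij with h | h
      · exact List.pairwise_iff_get.1 hM i j h
      · exact hsym _ _ (List.pairwise_iff_get.1 hM j i h)
    have h1 := hadj _ (M.get_mem i)
    have h2 := hadj _ (M.get_mem j)
    generalize M.get i = p at *
    generalize M.get j = q at *
    rw [Finset.card_le_one]
    have key : ∀ a ∈ (({w, f p.1, f p.2} : Finset V) ∩ {w, f q.1, f q.2}), a = w := by
      intro a ha
      simp only [Finset.mem_inter, Finset.mem_insert, Finset.mem_singleton] at ha
      obtain ⟨e1, e2, e3, e4⟩ := hd
      have e1' := hf.ne e1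
      have e2' := hf.ne e2
      have e3' := hf.ne e3
      have e4' := hf.ne e4
      rcases ha with ⟨rfl | rfl | rfl, h | h | h⟩ <;> first | rfl | exact h | exact absurd h ‹_›
    intro a ha b hb
    rw [key a ha, key b hb]
  · rw [Fintype.card_fin]
    refine (Finset.card_union_le _ _).trans ((Nat.add_le_add (List.toFinset_card_le _)
      (List.toFinset_card_le _)).trans ?_)
    simp only [List.length_map]
    omega
  · intro x hx a b ha hb hab
    rw [Finset.mem_singleton] at hx
    subst hx
    obtain ⟨i, rfl⟩ := hN a ha
    obtain ⟨j, rfl⟩ := hN b hb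
    simp only [Finset.mem_union, List.mem_toFinset, List.mem_map]
    rcases hcov i j ha hb hab with h | h | h | h
    · exact Or.inr (Or.inr (Or.inl ⟨_, h, rfl⟩))
    · exact Or.inr (Or.inr (Or.inl ⟨_, h, Sym2.eq_swap⟩))
    · exact Or.inl (Or.inr ⟨_, h, rfl⟩)
    · exact Or.inr (Or.inl (Or.inr ⟨_, h, rfl⟩))
  · intro i a ha b hb hab hna hnb
    simp only [Finset.mem_insert, Finset.mem_singleton] at ha hb hna hnb
    have hmem : s(f (M.get i).1, f (M.get i).2) ∈ ((M.map fun p => s(f p.1, f p.2)).toFinset ∪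
      (Q.map fun q => s(w, f q)).toFinset) := by
      simp only [Finset.mem_union, List.mem_toFinset, List.mem_map]
      exact Or.inl ⟨_, M.get_mem i, rfl⟩
    rcases ha with h | h | h
    · exact absurd h hna
    · rcases hb with h' | h' | h'
      · exact absurd h' hnb
      · exact absurd (h.trans h'.symm) hab
      · rw [h, h']; exact hmem
    · rcases hb with h' | h' | h'
      · exact absurd h' hnb
      · rw [h, h', Sym2.eq_swap]; exact hmem
      · exact absurd (h.trans h'.symm) hab

lemma nm_aux [Finite V] [DecidableEq V] {G : SimpleGraph V} (hrob : Robust G)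
    (hnored : ¬ ∃ V₀ : Finset V, ReducibleVertexSet G V₀) (w : V)
    (f : Fin 6 → V) (hf : Function.Injective f) (hN : ∀ u, G.Adj w u → ∃ i, f i = u)
    (bits : List ℕ) (certs : List (List (Fin 6 × Fin 6) × List (Fin 6)))
    (cuts : List (List (Fin 6)))
    (hen : enum bits 0 (fun m => tryCert m (certs.map compile) || tryCut m (cuts.map cutMask))
      = true)
    (hbits : ∀ i j : Fin 6, i < j → G.Adj w (f i) → G.Adj w (f j) → G.Adj (f i) (f j) →
      6 * i.val + j.val ∈ bits)
    (hcerts : ∀ c ∈ certs, c.2.length ≤ c.1.length ∧ (∀ p ∈ c.1, p.1 < p.2) ∧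
      c.1.Pairwise (fun p q => p.1 ≠ q.1 ∧ p.1 ≠ q.2 ∧ p.2 ≠ q.1 ∧ p.2 ≠ q.2))
    (hcuts : ∀ A ∈ cuts, A.length ≤ 4 ∧ ∃ a ∈ A, G.Adj w (f a)) : False := by
  classical
  let g : ℕ → Bool := fun k => decide (∃ i j : Fin 6, k = 6 * i.val + j.val ∧ i < j ∧
    G.Adj w (f i) ∧ G.Adj w (f j) ∧ G.Adj (f i) (f j))
  have hm := enum_build g _ bits 0 hen
  have hbit : ∀ i j : Fin 6, i < j → ((build g bits 0).testBit (6 * i.val + j.val) = true ↔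
      G.Adj w (f i) ∧ G.Adj w (f j) ∧ G.Adj (f i) (f j)) := by
    intro i j hij
    rw [testBit_build]
    simp only [Nat.zero_testBit, Bool.false_or, Bool.and_eq_true, decide_eq_true_eq, g]
    constructor
    · rintro ⟨-, i', j', he, -, h⟩
      have : i = i' := by ext; omega
      have : j = j' := by ext; omega
      subst i' j'
      exact h
    · intro h
      exact ⟨hbits i j hij h.1 h.2.1 h.2.2, i, j, rfl, hij, h⟩
  generalize build g bits 0 = m at hm hbit
  rw [Bool.or_eq_true] at hm
  rcases hm with hm | hm
  · obtain ⟨c', hc', h1, h2⟩ := of_tryCert _ _ hm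
    obtain ⟨c, hc, rfl⟩ := List.mem_map.1 hc'
    obtain ⟨hl, hlt, hpw⟩ := hcerts c hc
    have hcov : ∀ i j : Fin 6, i < j → G.Adj w (f i) → G.Adj w (f j) → G.Adj (f i) (f j) →
        (i, j) ∈ c.1 ∨ i ∈ c.2 ∨ j ∈ c.2 := by
      intro i j hij ha hb hab
      have ht := (hbit i j hij).2 ⟨ha, hb, hab⟩
      rw [← h2, Nat.testBit_and, Bool.and_eq_true] at ht
      have ht2 := ht.2
      rw [compile, Nat.testBit_or, Bool.or_eq_true, testBit_pairMask, testBit_pairMask,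
        List.mem_filter] at ht2
      simpa using ht2.imp id (fun h => h.2)
    refine wke hnored w f hf hN c.1 c.2 hl hpw ?_ ?_
    · intro p hp
      have : (pairMask c.1).testBit (6 * p.1.val + p.2.val) = true :=
        (testBit_pairMask _ _ _).2 hp
      have h1' : m &&& pairMask c.1 = pairMask c.1 := h1
      rw [← h1', Nat.testBit_and, Bool.and_eq_true] at this
      exact (hbit _ _ (hlt p hp)).1 this.1
    · intro i j ha hb hab
      rcases lt_trichotomy i j with h | h | h
      · rcases hcov i j h ha hb hab with h | h | h <;> simp [h]
      · exact absurd (by rw [h]) hab.ne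
      · rcases hcov j i h hb ha hab.symm with h | h | h <;> simp [h]
  · obtain ⟨c', hc', h1⟩ := of_tryCut _ _ hm
    obtain ⟨A, hA, rfl⟩ := List.mem_map.1 hc'
    obtain ⟨hl, a, ha, hwa⟩ := hcuts A hA
    have hno : ∀ i j : Fin 6, i < j → G.Adj w (f i) → G.Adj w (f j) → G.Adj (f i) (f j) →
        (i ∈ A ↔ j ∈ A) := by
      intro i j hij ha hb hab
      have ht := (hbit i j hij).2 ⟨ha, hb, hab⟩
      by_contra hne
      have : (cutMask A).testBit (6 * i.val + j.val) = true := by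
        rw [cutMask, testBit_pairMask, List.mem_filter]
        refine ⟨mem_allPairs i j hij, ?_⟩
        by_cases h1 : i ∈ A <;> by_cases h2 : j ∈ A <;> simp_all
      have h0 : (m &&& cutMask A).testBit (6 * i.val + j.val) = true := by
        rw [Nat.testBit_and, ht, this]; rfl
      rw [h1] at h0
      simp at h0
    have h5 := cut hrob w ((A.toFinset.image f : Finset V) : Set V) (f a)
      (by simpa using ⟨a, ha, rfl⟩) hwa (by
        intro x hx y hwx hwy hxy
        obtain ⟨j, rfl⟩ := hN y hwy
        simp only [Finset.coe_image, List.coe_toFinset, Set.mem_image, Set.mem_ofPred_eq] at hx ⊢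
        obtain ⟨i, hi, rfl⟩ := hx
        refine ⟨j, ?_, rfl⟩
        rcases lt_trichotomy i j with h | h | h
        · exact (hno i j h hwx hwy hxy).1 hi
        · exact h ▸ hi
        · exact (hno j i h hwy hwx hxy.symm).2 hi)
    rw [Set.ncard_coe_finset] at h5
    have := (Finset.card_image_le (s := A.toFinset) (f := f)).trans (List.toFinset_card_le A)
    omega

lemma nm [Finite V] [DecidableEq V] {G : SimpleGraph V} (hrob : Robust G)
    (hnored : ¬ ∃ V₀ : Finset V, ReducibleVertexSet G V₀) (w : V)
    (hw : (G.neighborSet w).ncard ≤ 6) (c a b : V) (hc : G.Adj w c) (ha : G.Adj w a)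
    (hb : G.Adj w b) (hca : c ≠ a) (hcb : c ≠ b) (hab : a ≠ b) : G.Adj c a ∨ G.Adj c b := by
  classical
  by_contra hcon
  push Not at hcon
  obtain ⟨hna, hnb⟩ := hcon
  have h5 := deg5 hrob hnored w
  obtain ⟨N, hNe⟩ := (Set.toFinite (G.neighborSet w)).exists_finset_coe
  have hmem : ∀ u, u ∈ N ↔ G.Adj w u := by
    intro u
    rw [← Finset.mem_coe, hNe]; rfl
  rw [← hNe, Set.ncard_coe_finset] at hw h5
  have hR : (N \ {a, b, c}).card = N.card - 3 := by
    rw [Finset.card_sdiff_of_subset]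
    · rw [Finset.card_eq_three.2 ⟨a, b, c, hab, hca.symm, hcb.symm, rfl⟩]
    · intro x hx
      simp only [Finset.mem_insert, Finset.mem_singleton] at hx
      rcases hx with rfl | rfl | rfl <;> simpa [hmem]
  have hcase : N.card = 5 ∨ N.card = 6 := by omega
  have hRm : ∀ u, u ∈ N \ {a, b, c} ↔ G.Adj w u ∧ u ≠ a ∧ u ≠ b ∧ u ≠ c := by
    intro u
    simp [hmem]
  rcases hcase with h | h
  · rw [h] at hR
    obtain ⟨d, e, hde, hEq⟩ := Finset.card_eq_two.1 hR
    simp only [hEq, Finset.mem_insert, Finset.mem_singleton] at hRm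
    have hd := (hRm d).1 (by simp)
    have he := (hRm e).1 (by simp)
    have h0 := ha.ne'; have h1 := hb.ne'; have h2 := hc.ne'; have h3 := hd.1.ne'; have h4 := he.1.ne'
    refine nm_aux hrob hnored w ![a, b, c, d, e, w] ?_ ?_ bits5 certs5 cuts5 ?_ ?_ ?_ ?_
    · rw [← List.nodup_ofFn]
      simp [List.ofFn_succ]
      grind
    · intro u hu
      by_cases hu' : u = a ∨ u = b ∨ u = c
      · rcases hu' with rfl | rfl | rfl
        · exact ⟨0, rfl⟩
        · exact ⟨1, rfl⟩
        · exact ⟨2, rfl⟩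
      · push Not at hu'
        rcases (hRm u).2 ⟨hu, hu'⟩ with rfl | rfl
        · exact ⟨3, rfl⟩
        · exact ⟨4, rfl⟩
    · rw [← masks5_eq, ← cmasks5_eq]; exact enum5
    · intro i j hij h1 h2 h12
      have hx : i ≠ 5 ∧ j ≠ 5 ∧ ¬ (i = 0 ∧ j = 2) ∧ ¬ (i = 1 ∧ j = 2) := by
        refine ⟨?_, ?_, ?_, ?_⟩
        · rintro rfl; exact h1.ne rfl
        · rintro rfl; exact h2.ne rfl
        · rintro ⟨rfl, rfl⟩; exact hna h12.symm
        · rintro ⟨rfl, rfl⟩; exact hnb h12.symm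
      clear h1 h2 h12
      revert i j
      decide
    · decide
    · have : ∀ A ∈ cuts5, A.length ≤ 4 ∧ ∃ a ∈ A, a ≠ 5 := by decide
      intro A hA
      obtain ⟨h1, a', h2, h3⟩ := this A hA
      refine ⟨h1, a', h2, ?_⟩
      fin_cases a'
      · exact ha
      · exact hb
      · exact hc
      · exact hd.1
      · exact he.1
      · exact absurd rfl h3
  · rw [h] at hR
    obtain ⟨d, e, e', hde, hde', hee', hEq⟩ := Finset.card_eq_three.1 hR
    simp only [hEq, Finset.mem_insert, Finset.mem_singleton] at hRm
    have hd := (hRm d).1 (by simp)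
    have he := (hRm e).1 (by simp)
    have he' := (hRm e').1 (by simp)
    refine nm_aux hrob hnored w ![a, b, c, d, e, e'] ?_ ?_ bits6 certs6 cuts6 ?_ ?_ ?_ ?_
    · rw [← List.nodup_ofFn]
      simp [List.ofFn_succ]
      grind
    · intro u hu
      by_cases hu' : u = a ∨ u = b ∨ u = c
      · rcases hu' with rfl | rfl | rfl
        · exact ⟨0, rfl⟩
        · exact ⟨1, rfl⟩
        · exact ⟨2, rfl⟩
      · push Not at hu'
        rcases (hRm u).2 ⟨hu, hu'⟩ with rfl | rfl | rfl
        · exact ⟨3, rfl⟩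
        · exact ⟨4, rfl⟩
        · exact ⟨5, rfl⟩
    · rw [← masks6_eq, ← cmasks6_eq]; exact enum6
    · intro i j hij h1 h2 h12
      have hx : ¬ (i = 0 ∧ j = 2) ∧ ¬ (i = 1 ∧ j = 2) := by
        refine ⟨?_, ?_⟩
        · rintro ⟨rfl, rfl⟩; exact hna h12.symm
        · rintro ⟨rfl, rfl⟩; exact hnb h12.symm
      clear h1 h2 h12
      revert i j
      decide
    · decide +kernel
    · have : ∀ A ∈ cuts6, A.length ≤ 4 ∧ ∃ a ∈ A, a = a := by decide +kernel
      intro A hA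
      obtain ⟨h1, a', h2, h3⟩ := this A hA
      refine ⟨h1, a', h2, ?_⟩
      fin_cases a'
      · exact ha
      · exact hb
      · exact hc
      · exact hd.1
      · exact he.1
      · exact he'.1

/-! ### Adjacent vertices of low degree -/

lemma pairA [DecidableEq V] {G : SimpleGraph V}
    (hnored : ¬ ∃ V₀ : Finset V, ReducibleVertexSet G V₀) (w₁ w₂ a b c d o : V)
    (hnd : [w₁, w₂, a, b, c, d].Nodup)
    (hC : ∀ u ∈ [a, b, c, d], G.Adj w₁ u ∧ G.Adj w₂ u)
    (h1 : ∀ u, G.Adj w₁ u → u ∈ [w₂, a, b, c, d] ∨ u = o)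
    (h2 : ∀ u, G.Adj w₂ u → u ∈ [w₁, a, b, c, d])
    (hab : G.Adj a b) (hbc : G.Adj b c) (hcd : G.Adj c d) (hda : G.Adj d a) : False := by
  simp only [List.mem_cons, List.not_mem_nil, or_false, forall_eq_or_imp, forall_eq] at hC h1 h2
  refine red_fin hnored ![w₁, w₂, a, b, c, d] (by simpa [List.ofFn_succ] using hnd) [0, 1]
    (by simp) ![(0, 2, 3), (0, 4, 5), (1, 3, 4), (1, 5, 2)]
    [(0, 1), (2, 3), (2, 4), (2, 5), (3, 4), (3, 5), (4, 5)] [] [0] (fun _ => o)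
    (by decide) (by decide +kernel) (by decide +kernel) ?_ ?_ (by simp)
  · simp only [List.mem_cons, List.not_mem_nil, or_false, forall_eq_or_imp, forall_eq,
      Fin.exists_fin_succ]
    constructor
    · intro u hu
      have := h1 u hu
      simp
      grind
    · intro u hu
      have := h2 u hu
      simp
      grind
  · simp [Fin.forall_fin_succ]
    grind [SimpleGraph.adj_comm]

lemma pairB [DecidableEq V] {G : SimpleGraph V}
    (hnored : ¬ ∃ V₀ : Finset V, ReducibleVertexSet G V₀) (w₁ w₂ a b c p q : V)
    (hnd : [w₁, w₂, a, b, c, p, q].Nodup)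
    (hC : ∀ u ∈ [a, b, c], G.Adj w₁ u ∧ G.Adj w₂ u)
    (h1 : ∀ u, G.Adj w₁ u → u ∈ [w₂, a, b, c, p])
    (h2 : ∀ u, G.Adj w₂ u → u ∈ [w₁, a, b, c, q])
    (hp : G.Adj w₁ p) (hq : G.Adj w₂ q)
    (hpC : ∀ u ∈ [a, b, c], G.Adj p u ∧ G.Adj q u)
    (hab : G.Adj a b) (hbc : G.Adj b c) : False := by
  simp only [List.mem_cons, List.not_mem_nil, or_false, forall_eq_or_imp, forall_eq] at hC h1 h2 hpC
  refine red_fin hnored ![w₁, w₂, a, b, c, p, q] (by simpa [List.ofFn_succ] using hnd) [0, 1]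
    (by simp) ![(0, 5, 2), (0, 3, 4), (1, 6, 4), (1, 2, 3)]
    [(0, 1), (2, 3), (3, 4), (2, 4), (5, 2), (6, 4), (0, 5), (1, 6)] [(0, 6), (1, 5)] []
    (fun _ => w₁)
    (by decide) (by decide +kernel) (by decide +kernel) ?_ ?_ ?_
  · simp only [List.mem_cons, List.not_mem_nil, or_false, forall_eq_or_imp, forall_eq,
      Fin.exists_fin_succ]
    constructor
    · intro u hu
      have := h1 u hu
      simp
      grind
    · intro u hu
      have := h2 u hu
      simp
      grind
  · simp [Fin.forall_fin_succ]
    grind [SimpleGraph.adj_comm]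
  · simp
    simp at hnd
    constructor
    · intro h
      have := h1 _ h
      grind
    · intro h
      have := h2 _ h
      grind

lemma pairD [DecidableEq V] {G : SimpleGraph V}
    (hnored : ¬ ∃ V₀ : Finset V, ReducibleVertexSet G V₀) (w₁ w₂ a b c d z : V)
    (hnd : [w₁, w₂, a, b, c, d, z].Nodup) (hw : G.Adj w₁ w₂)
    (hC : ∀ u ∈ [a, b, c, d, z], G.Adj w₁ u ∧ G.Adj w₂ u)
    (h1 : ∀ u, G.Adj w₁ u → u ∈ [w₂, a, b, c, d, z])
    (h2 : ∀ u, G.Adj w₂ u → u ∈ [w₁, a, b, c, d, z])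
    (hab : G.Adj a b) (hbc : G.Adj b c) (hcd : G.Adj c d) (hda : G.Adj d a)
    (hac : ¬ G.Adj a c) : False := by
  simp only [List.mem_cons, List.not_mem_nil, or_false, forall_eq_or_imp, forall_eq] at hC h1 h2
  refine red_fin hnored ![w₁, w₂, a, b, c, d, z] (by simpa [List.ofFn_succ] using hnd) [0, 1]
    (by simp) ![(0, 1, 6), (0, 2, 3), (0, 4, 5), (1, 3, 4), (1, 5, 2)]
    [(0, 1), (2, 3), (3, 4), (4, 5), (5, 2), (3, 5), (6, 2), (6, 3), (6, 4), (6, 5)] [(2, 4)] []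
    (fun _ => w₁)
    (by decide) (by decide +kernel) (by decide +kernel) ?_ ?_ ?_
  · simp only [List.mem_cons, List.not_mem_nil, or_false, forall_eq_or_imp, forall_eq,
      Fin.exists_fin_succ]
    constructor
    · intro u hu
      have := h1 u hu
      simp
      grind
    · intro u hu
      have := h2 u hu
      simp
      grind
  · simp [Fin.forall_fin_succ]
    grind [SimpleGraph.adj_comm]
  · simpa using hac

lemma pairE [DecidableEq V] {G : SimpleGraph V}
    (hnored : ¬ ∃ V₀ : Finset V, ReducibleVertexSet G V₀) (w₁ w₂ a b c d p q : V)
    (hnd : [w₁, w₂, a, b, c, d, p, q].Nodup) (hw : G.Adj w₁ w₂)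
    (hC : ∀ u ∈ [a, b, c, d], G.Adj w₁ u ∧ G.Adj w₂ u)
    (h1 : ∀ u, G.Adj w₁ u → u ∈ [w₂, a, b, c, d, p])
    (h2 : ∀ u, G.Adj w₂ u → u ∈ [w₁, a, b, c, d, q])
    (hp : G.Adj w₁ p) (hq : G.Adj w₂ q)
    (hpC : ∀ u ∈ [a, b, c, d], G.Adj p u ∧ G.Adj q u)
    (hab : G.Adj a b) (hbc : G.Adj b c) (hcd : G.Adj c d) (hda : G.Adj d a)
    (hac : ¬ G.Adj a c) : False := by
  simp only [List.mem_cons, List.not_mem_nil, or_false, forall_eq_or_imp, forall_eq] at hC h1 h2 hpC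
  refine red_fin hnored ![w₁, w₂, a, b, c, d, p, q] (by simpa [List.ofFn_succ] using hnd) [0, 1]
    (by simp) ![(0, 1, 2), (0, 6, 3), (0, 4, 5), (1, 7, 5), (1, 3, 4)]
    [(0, 1), (2, 3), (3, 4), (4, 5), (5, 2), (3, 5), (6, 3), (7, 5), (0, 6), (1, 7)]
    [(2, 4), (0, 7), (1, 6)] [] (fun _ => w₁)
    (by decide) (by decide +kernel) (by decide +kernel) ?_ ?_ ?_
  · simp only [List.mem_cons, List.not_mem_nil, or_false, forall_eq_or_imp, forall_eq,
      Fin.exists_fin_succ]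
    constructor
    · intro u hu
      have := h1 u hu
      simp
      grind
    · intro u hu
      have := h2 u hu
      simp
      grind
  · simp [Fin.forall_fin_succ]
    grind [SimpleGraph.adj_comm]
  · simp
    simp at hnd
    refine ⟨hac, ?_, ?_⟩
    · intro h
      have := h1 _ h
      grind
    · intro h
      have := h2 _ h
      grind

lemma triC [DecidableEq V] {G : SimpleGraph V}
    (hnored : ¬ ∃ V₀ : Finset V, ReducibleVertexSet G V₀) (w₁ w₂ w₃ a b c d o₁ o₃ : V)
    (hnd : [w₁, w₂, w₃, a, b, c, d].Nodup)
    (hC : ∀ u ∈ [a, b, c, d], G.Adj w₁ u ∧ G.Adj w₂ u ∧ G.Adj w₃ u)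
    (h1 : ∀ u, G.Adj w₁ u → u ∈ [w₂, a, b, c, d] ∨ u = o₁)
    (h2 : ∀ u, G.Adj w₂ u → u ∈ [w₁, w₃, a, b, c, d])
    (h3 : ∀ u, G.Adj w₃ u → u ∈ [w₂, a, b, c, d] ∨ u = o₃)
    (hab : G.Adj a b) (hac : G.Adj a c) (had : G.Adj a d) (hbc : G.Adj b c) (hbd : G.Adj b d)
    (hcd : G.Adj c d) : False := by
  simp only [List.mem_cons, List.not_mem_nil, or_false, forall_eq_or_imp, forall_eq] at hC h1 h2 h3
  refine red_fin hnored ![w₁, w₂, w₃, a, b, c, d] (by simpa [List.ofFn_succ] using hnd) [0, 1, 2]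
    (by simp) ![(0, 3, 4), (0, 5, 6), (1, 3, 5), (1, 4, 6), (2, 3, 6), (2, 4, 5)]
    [(0, 1), (0, 2), (1, 2), (3, 4), (3, 5), (3, 6), (4, 5), (4, 6), (5, 6)]
    [] [0, 2] ![o₁, o₁, o₃, o₁, o₁, o₁, o₁]
    (by decide) (by decide +kernel) (by decide +kernel) ?_ ?_ (by simp)
  · simp only [List.mem_cons, List.not_mem_nil, or_false, forall_eq_or_imp, forall_eq,
      Fin.exists_fin_succ]
    refine ⟨?_, ?_, ?_⟩
    · intro u hu
      have := h1 u hu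
      simp
      grind
    · intro u hu
      have := h2 u hu
      simp
      grind
    · intro u hu
      have := h3 u hu
      simp
      grind
  · simp [Fin.forall_fin_succ]
    grind [SimpleGraph.adj_comm]

lemma ex_list [DecidableEq V] (C : Finset V) (n : ℕ) (h : C.card = n) :
    ∃ l : List V, l.length = n ∧ l.Nodup ∧ ∀ u, u ∈ C ↔ u ∈ l :=
  ⟨C.toList, by simp [h], C.nodup_toList, by simp⟩

lemma ex3 [DecidableEq V] (C : Finset V) (h : C.card = 3) :
    ∃ a b c, [a, b, c].Nodup ∧ ∀ u, u ∈ C ↔ u ∈ [a, b, c] := by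
  obtain ⟨l, hl, h1, h2⟩ := ex_list C 3 h
  match l, hl with
  | [a, b, c], _ => exact ⟨a, b, c, h1, h2⟩

lemma ex4 [DecidableEq V] (C : Finset V) (h : C.card = 4) :
    ∃ a b c d, [a, b, c, d].Nodup ∧ ∀ u, u ∈ C ↔ u ∈ [a, b, c, d] := by
  obtain ⟨l, hl, h1, h2⟩ := ex_list C 4 h
  match l, hl with
  | [a, b, c, d], _ => exact ⟨a, b, c, d, h1, h2⟩

lemma ex5 [DecidableEq V] (C : Finset V) (h : C.card = 5) :
    ∃ a b c d e, [a, b, c, d, e].Nodup ∧ ∀ u, u ∈ C ↔ u ∈ [a, b, c, d, e] := by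
  obtain ⟨l, hl, h1, h2⟩ := ex_list C 5 h
  match l, hl with
  | [a, b, c, d, e], _ => exact ⟨a, b, c, d, e, h1, h2⟩

set_option maxHeartbeats 1000000 in
lemma pairA' [DecidableEq V] {G : SimpleGraph V}
    (hnored : ¬ ∃ V₀ : Finset V, ReducibleVertexSet G V₀) (w₁ w₂ o : V) (C : Finset V)
    (hw : w₁ ≠ w₂)
    (hC : ∀ u, u ∈ C ↔ G.Adj w₁ u ∧ G.Adj w₂ u) (h4 : C.card = 4)
    (h1 : ∀ u, G.Adj w₁ u → u ∈ C ∨ u = w₂ ∨ u = o)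
    (h2 : ∀ u, G.Adj w₂ u → u ∈ C ∨ u = w₁)
    (hnm : ∀ x ∈ C, ∀ y ∈ C, ∀ z ∈ C, x ≠ y → x ≠ z → y ≠ z → G.Adj x y ∨ G.Adj x z) :
    False := by
  obtain ⟨a, b, c, d, hnd, hm⟩ := ex4 C h4
  have e1 := G.loopless
  have hw1 : w₁ ∉ C := fun h => ((hC _).1 h).1.ne rfl
  have hw2 : w₂ ∉ C := fun h => ((hC _).1 h).2.ne rfl
  have ha : a ∈ C := (hm _).2 (by simp)
  have hb : b ∈ C := (hm _).2 (by simp)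
  have hc : c ∈ C := (hm _).2 (by simp)
  have hd : d ∈ C := (hm _).2 (by simp)
  simp only [List.nodup_cons, List.mem_cons, List.not_mem_nil, or_false, not_or] at hnd
  obtain ⟨⟨n1, n2, n3⟩, ⟨n4, n5⟩, n6, -⟩ := hnd
  have key : ∀ a b c d : V, a ∈ C → b ∈ C → c ∈ C → d ∈ C → [a, b, c, d].Nodup →
      (∀ u ∈ C, u ∈ [a, b, c, d]) →
      G.Adj a b → G.Adj b c → G.Adj c d → G.Adj d a → False := by
    intro a b c d ha hb hc hd hnd hm hab hbc hcd hda
    refine pairA hnored w₁ w₂ a b c d o ?_ ?_ ?_ ?_ hab hbc hcd hda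
    · rw [List.nodup_cons, List.nodup_cons]
      refine ⟨?_, ?_, hnd⟩
      · simp only [List.mem_cons, List.not_mem_nil, or_false]
        grind
      · simp only [List.mem_cons, List.not_mem_nil, or_false]
        grind
    · simp only [List.mem_cons, List.not_mem_nil, or_false]
      grind
    · intro u hu
      have h1' := h1 u hu
      have hm' := hm u
      simp only [List.mem_cons, List.not_mem_nil, or_false] at hm' ⊢
      tauto
    · intro u hu
      have h2' := h2 u hu
      have hm' := hm u
      simp only [List.mem_cons, List.not_mem_nil, or_false] at hm' ⊢
      tauto
  have hm' : ∀ u ∈ C, u = a ∨ u = b ∨ u = c ∨ u = d := by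
    intro u hu; simpa using (hm u).1 hu
  have k1 := key a b c d ha hb hc hd (by simp [n1, n2, n3, n4, n5, n6, Ne.symm n4, Ne.symm n6])
    (by intro u hu; have := hm' u hu; simp only [List.mem_cons, List.not_mem_nil, or_false]; tauto)
  have k2 := key a b d c ha hb hd hc (by simp [n1, n2, n3, n4, n5, n6, Ne.symm n4, Ne.symm n6])
    (by intro u hu; have := hm' u hu; simp only [List.mem_cons, List.not_mem_nil, or_false]; tauto)
  have k3 := key a c b d ha hc hb hd (by simp [n1, n2, n3, n4, n5, n6, Ne.symm n4, Ne.symm n6])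
    (by intro u hu; have := hm' u hu; simp only [List.mem_cons, List.not_mem_nil, or_false]; tauto)
  have a1 := hnm a ha b hb c hc n1 n2 n4
  have a2 := hnm a ha b hb d hd n1 n3 n5
  have a3 := hnm a ha c hc d hd n2 n3 n6
  have b1 := hnm b hb a ha c hc (Ne.symm n1) n4 n2
  have b2 := hnm b hb a ha d hd (Ne.symm n1) n5 n3
  have b3 := hnm b hb c hc d hd n4 n5 n6
  have c1 := hnm c hc a ha b hb (Ne.symm n2) (Ne.symm n4) n1
  have c2 := hnm c hc a ha d hd (Ne.symm n2) n6 n3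
  have c3 := hnm c hc b hb d hd (Ne.symm n4) n6 n5
  have d1 := hnm d hd a ha b hb (Ne.symm n3) (Ne.symm n5) n1
  have d2 := hnm d hd a ha c hc (Ne.symm n3) (Ne.symm n6) n2
  have d3 := hnm d hd b hb c hc (Ne.symm n5) (Ne.symm n6) n4
  rw [G.adj_comm b a] at b1 b2
  rw [G.adj_comm c a, G.adj_comm c b] at c1
  rw [G.adj_comm c a] at c2
  rw [G.adj_comm c b] at c3
  rw [G.adj_comm d a, G.adj_comm d b] at d1
  rw [G.adj_comm d a, G.adj_comm d c] at d2
  rw [G.adj_comm d b, G.adj_comm d c] at d3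
  rw [G.adj_comm d a] at k1 
  rw [G.adj_comm d c, G.adj_comm c a] at k2
  rw [G.adj_comm c b, G.adj_comm d a] at k3
  clear key hm hm' hnm h1 h2 hC e1
  grind

set_option maxHeartbeats 2000000 in
lemma pair [Finite V] [DecidableEq V] {G : SimpleGraph V} (hrob : Robust G)
    (hnored : ¬ ∃ V₀ : Finset V, ReducibleVertexSet G V₀) (w₁ w₂ : V) (hw : G.Adj w₁ w₂)
    (l1 : (G.neighborSet w₁).ncard ≤ 6) (l2 : (G.neighborSet w₂).ncard ≤ 6) :
    (G.neighborSet w₁).ncard = 6 ∧ (G.neighborSet w₂).ncard = 6 ∧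
    ∀ a b, a ≠ b → G.Adj w₁ a → G.Adj w₂ a → G.Adj w₁ b → G.Adj w₂ b → G.Adj a b := by
  have := Fintype.ofFinite V
  have : DecidableRel G.Adj := Classical.decRel _
  have g1 := deg5 hrob hnored w₁
  have g2 := deg5 hrob hnored w₂
  have nm1 := nm hrob hnored w₁ l1
  have nm2 := nm hrob hnored w₂ l2
  set N1 : Finset V := (G.neighborSet w₁).toFinset with hN1
  set N2 : Finset V := (G.neighborSet w₂).toFinset with hN2
  have m1 : ∀ u, u ∈ N1 ↔ G.Adj w₁ u := by simp [hN1]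
  have m2 : ∀ u, u ∈ N2 ↔ G.Adj w₂ u := by simp [hN2]
  have E1 : (G.neighborSet w₁).ncard = N1.card := Set.ncard_eq_toFinset_card' _
  have E2 : (G.neighborSet w₂).ncard = N2.card := Set.ncard_eq_toFinset_card' _
  rw [E1] at l1 g1 ⊢
  rw [E2] at l2 g2 ⊢
  set C := N1 ∩ N2 with hC
  have mC : ∀ u, u ∈ C ↔ G.Adj w₁ u ∧ G.Adj w₂ u := by simp [hC, m1, m2]
  set P1 := (N1 \ N2).erase w₂ with hP1
  set P2 := (N2 \ N1).erase w₁ with hP2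
  have mP1 : ∀ u, u ∈ P1 ↔ G.Adj w₁ u ∧ ¬ G.Adj w₂ u ∧ u ≠ w₂ := by simp [hP1, m1, m2]; tauto
  have mP2 : ∀ u, u ∈ P2 ↔ G.Adj w₂ u ∧ ¬ G.Adj w₁ u ∧ u ≠ w₁ := by simp [hP2, m1, m2]; tauto
  have c1 : N1.card = C.card + P1.card + 1 := by
    have h1 := Finset.card_inter_add_card_sdiff N1 N2
    have h2 := Finset.card_erase_add_one (s := N1 \ N2) (a := w₂) (by simp [m1, m2, hw])
    rw [← hP1] at h2
    rw [← hC] at h1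
    omega
  have c2 : N2.card = C.card + P2.card + 1 := by
    have h1 := Finset.card_inter_add_card_sdiff N2 N1
    have h2 := Finset.card_erase_add_one (s := N2 \ N1) (a := w₁) (by simp [m1, m2, hw.symm])
    rw [Finset.inter_comm, ← hC] at h1
    rw [← hP2] at h2
    omega
  have p1 : P1.card ≤ 1 := by
    rw [Finset.card_le_one]
    intro a ha b hb
    by_contra hab
    rw [mP1] at ha hb
    have := nm1 w₂ a b hw ha.1 hb.1 (Ne.symm ha.2.2) (Ne.symm hb.2.2) hab
    tauto
  have p2 : P2.card ≤ 1 := by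
    rw [Finset.card_le_one]
    intro a ha b hb
    by_contra hab
    rw [mP2] at ha hb
    have := nm2 w₁ a b hw.symm ha.1 hb.1 (Ne.symm ha.2.2) (Ne.symm hb.2.2) hab
    tauto
  have nmC : ∀ x ∈ C, ∀ y ∈ C, ∀ z ∈ C, x ≠ y → x ≠ z → y ≠ z → G.Adj x y ∨ G.Adj x z := by
    intro x hx y hy z hz
    rw [mC] at hx hy hz
    exact nm1 x y z hx.1 hy.1 hz.1
  have pC : ∀ p ∈ P1, ∀ u ∈ C, G.Adj p u := by
    intro p hp u hu
    rw [mP1] at hp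
    rw [mC] at hu
    have hpu : p ≠ u := by rintro rfl; tauto
    rcases nm1 p w₂ u hp.1 hw hu.1 hp.2.2 hpu hu.2.ne with h | h
    · exact absurd h.symm hp.2.1
    · exact h
  have qC : ∀ p ∈ P2, ∀ u ∈ C, G.Adj p u := by
    intro p hp u hu
    rw [mP2] at hp
    rw [mC] at hu
    have hpu : p ≠ u := by rintro rfl; tauto
    rcases nm2 p w₁ u hp.1 hw.symm hu.2 hp.2.2 hpu hu.1.ne with h | h
    · exact absurd h.symm hp.2.1
    · exact h
  have hw1 : w₁ ∉ C := fun h => ((mC _).1 h).1.ne rfl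
  have hw2 : w₂ ∉ C := fun h => ((mC _).1 h).2.ne rfl
  have hwne := hw.ne
  have hwne' := hw.ne'
  have dec1 : ∀ u, G.Adj w₁ u → u ∈ C ∨ u ∈ P1 ∨ u = w₂ := by
    intro u hu; rw [mC, mP1]; tauto
  have dec2 : ∀ u, G.Adj w₂ u → u ∈ C ∨ u ∈ P2 ∨ u = w₁ := by
    intro u hu; rw [mC, mP2]; tauto
  have hP12 : ∀ u, u ∈ P1 → u ∉ P2 := by intro u; rw [mP1, mP2]; tauto
  have hP1C : ∀ u, u ∈ P1 → u ∉ C := by intro u; rw [mP1, mC]; tauto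
  have hP2C : ∀ u, u ∈ P2 → u ∉ C := by intro u; rw [mP2, mC]; tauto
  have hP1w : w₁ ∉ P1 ∧ w₂ ∉ P1 := by rw [mP1, mP1]; simp
  have hP2w : w₁ ∉ P2 ∧ w₂ ∉ P2 := by rw [mP2, mP2]; simp
  have hP1a : ∀ u ∈ P1, G.Adj w₁ u := by intro u; rw [mP1]; tauto
  have hP2a : ∀ u ∈ P2, G.Adj w₂ u := by intro u; rw [mP2]; tauto
  clear_value N1 N2 C P1 P2
  clear nm1 nm2 m1 m2 mP1 mP2 hC hP1 hP2 hN1 hN2 E1 E2 hrob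
  -- at most one private each
  rcases Nat.lt_or_ge P1.card 1 with z1 | z1
  · have e1 : P1 = ∅ := Finset.card_eq_zero.1 (by omega)
    rcases Nat.lt_or_ge P2.card 1 with z2 | z2
    · have e2 : P2 = ∅ := Finset.card_eq_zero.1 (by omega)
      subst e1 e2
      simp only [Finset.card_empty, Finset.notMem_empty, false_or] at *
      have : C.card = 4 ∨ C.card = 5 := by omega
      rcases this with h4 | h5
      · exact (pairA' hnored w₁ w₂ w₁ C hwne mC h4 (by grind) (by grind) nmC).elim
      · refine ⟨by omega, by omega, ?_⟩
        intro a c hac ha1 ha2 hc1 hc2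
        by_contra hn
        have ha := (mC a).2 ⟨ha1, ha2⟩
        have hc := (mC c).2 ⟨hc1, hc2⟩
        have : ((C.erase a).erase c).card = 3 := by
          rw [Finset.card_erase_of_mem (by simp [hc, Ne.symm hac]), Finset.card_erase_of_mem ha, h5]
        obtain ⟨b, d, z, hnd, hm⟩ := ex3 _ this
        simp only [Finset.mem_erase, List.mem_cons, List.not_mem_nil, or_false] at hm
        simp only [List.nodup_cons, List.mem_cons, List.not_mem_nil, or_false, not_or] at hnd
        have hb := (hm b).2 (by simp)
        have hd := (hm d).2 (by simp)
        have hz := (hm z).2 (by simp)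
        refine pairD hnored w₁ w₂ a b c d z ?_ hw ?_ ?_ ?_ ?_ ?_ ?_ ?_ hn
        · simp only [List.nodup_cons, List.mem_cons, List.not_mem_nil, or_false, not_or]
          clear nmC hnored
          grind
        · simp only [List.mem_cons, List.not_mem_nil, or_false]
          clear nmC hnored
          grind
        · simp only [List.mem_cons, List.not_mem_nil, or_false]
          clear nmC hnored
          grind
        · simp only [List.mem_cons, List.not_mem_nil, or_false]
          clear nmC hnored
          grind
        · have := nmC a ha b hb.2.2 c hc (Ne.symm hb.2.1) hac hb.1
          tauto
        · have := nmC c hc b hb.2.2 a ha (Ne.symm hb.1) (Ne.symm hac) hb.2.1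
          rw [G.adj_comm c a, G.adj_comm c b] at this
          tauto
        · have := nmC c hc d hd.2.2 a ha (Ne.symm hd.1) (Ne.symm hac) hd.2.1
          rw [G.adj_comm c a] at this
          tauto
        · have := nmC a ha d hd.2.2 c hc (Ne.symm hd.2.1) hac hd.1
          rw [G.adj_comm a d] at this
          tauto
    · obtain ⟨q, rfl⟩ := Finset.card_eq_one.1 (show P2.card = 1 by omega)
      subst e1
      simp only [Finset.card_empty, Finset.card_singleton, Finset.notMem_empty, false_or,
        Finset.mem_singleton] at *
      exact (pairA' hnored w₂ w₁ q C hwne' (fun u => by rw [mC, and_comm]) (by omega)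
        (by grind) (by grind) nmC).elim
  · obtain ⟨p, rfl⟩ := Finset.card_eq_one.1 (show P1.card = 1 by omega)
    rcases Nat.lt_or_ge P2.card 1 with z2 | z2
    · have e2 : P2 = ∅ := Finset.card_eq_zero.1 (by omega)
      subst e2
      simp only [Finset.card_empty, Finset.card_singleton, Finset.notMem_empty, false_or,
        Finset.mem_singleton] at *
      exact (pairA' hnored w₁ w₂ p C hwne mC (by omega)
        (by grind) (by grind) nmC).elim
    · obtain ⟨q, rfl⟩ := Finset.card_eq_one.1 (show P2.card = 1 by omega)
      simp only [Finset.card_singleton, Finset.mem_singleton, forall_eq] at *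
      have : C.card = 3 ∨ C.card = 4 := by omega
      rcases this with h3 | h4
      · exfalso
        have sep : ∀ x ∈ C, w₁ ≠ x ∧ w₂ ≠ x ∧ x ≠ p ∧ x ≠ q := by
          intro x hx
          refine ⟨?_, ?_, ?_, ?_⟩ <;> (rintro rfl; tauto)
        have key : ∀ a b c, a ∈ C → b ∈ C → c ∈ C → a ≠ b → a ≠ c → b ≠ c →
            (∀ u ∈ C, u = a ∨ u = b ∨ u = c) → G.Adj a b → G.Adj b c → False := by
          intro a b c ha hb hc n1 n2 n3 hm hab hbc
          refine pairB hnored w₁ w₂ a b c p q ?_ ?_ ?_ ?_ hP1a hP2a ?_ hab hbc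
          · simp only [List.nodup_cons, List.nodup_nil, List.mem_cons, List.not_mem_nil, or_false, not_or]
            have sa := sep a ha
            have sb := sep b hb
            have sc := sep c hc
            tauto
          all_goals
            simp only [List.mem_cons, List.not_mem_nil, or_false]
            clear nmC hnored
            grind
        obtain ⟨a, b, c, hnd, hm⟩ := ex3 C h3
        simp only [List.mem_cons, List.not_mem_nil, or_false] at hm
        simp only [List.nodup_cons, List.mem_cons, List.not_mem_nil, or_false, not_or] at hnd
        have ha := (hm a).2 (by simp)
        have hb := (hm b).2 (by simp)
        have hc := (hm c).2 (by simp)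
        obtain ⟨⟨n1, n2⟩, n3, -⟩ := hnd
        have k1 := key a b c ha hb hc n1 n2 n3 (fun u hu => (hm u).1 hu)
        have k2 := key b a c hb ha hc (Ne.symm n1) n3 n2 (fun u hu => by have := (hm u).1 hu; tauto)
        have k3 := key a c b ha hc hb n2 n1 (Ne.symm n3) (fun u hu => by have := (hm u).1 hu; tauto)
        have a1 := nmC a ha b hb c hc n1 n2 n3
        have a2 := nmC b hb a ha c hc (Ne.symm n1) n3 n2
        have a3 := nmC c hc a ha b hb (Ne.symm n2) (Ne.symm n3) n1
        rw [G.adj_comm b a] at a2 k2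
        rw [G.adj_comm c a, G.adj_comm c b] at a3
        rw [G.adj_comm c b] at k3
        tauto
      · refine ⟨by omega, by omega, ?_⟩
        intro a c hac ha1 ha2 hc1 hc2
        by_contra hn
        have ha := (mC a).2 ⟨ha1, ha2⟩
        have hc := (mC c).2 ⟨hc1, hc2⟩
        have : ((C.erase a).erase c).card = 2 := by
          rw [Finset.card_erase_of_mem (by simp [hc, Ne.symm hac]), Finset.card_erase_of_mem ha, h4]
        obtain ⟨b, d, hbd, hE⟩ := Finset.card_eq_two.1 this
        have hm : ∀ u, (u ≠ c ∧ u ≠ a ∧ u ∈ C) ↔ u = b ∨ u = d := by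
          intro u
          have : u ∈ (C.erase a).erase c ↔ u ∈ ({b, d} : Finset V) := by rw [hE]
          simpa using this
        have hb := (hm b).2 (by simp)
        have hd := (hm d).2 (by simp)
        refine pairE hnored w₁ w₂ a b c d p q ?_ hw ?_ ?_ ?_ hP1a hP2a ?_ ?_ ?_ ?_ ?_ hn
        · simp only [List.nodup_cons, List.mem_cons, List.not_mem_nil, or_false, not_or]
          clear nmC hnored
          grind
        · simp only [List.mem_cons, List.not_mem_nil, or_false]
          clear nmC hnored
          grind
        · simp only [List.mem_cons, List.not_mem_nil, or_false]
          clear nmC hnored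
          grind
        · simp only [List.mem_cons, List.not_mem_nil, or_false]
          clear nmC hnored
          grind
        · simp only [List.mem_cons, List.not_mem_nil, or_false]
          clear nmC hnored
          grind
        · have := nmC a ha b hb.2.2 c hc (Ne.symm hb.2.1) hac hb.1
          tauto
        · have := nmC c hc b hb.2.2 a ha (Ne.symm hb.1) (Ne.symm hac) hb.2.1
          rw [G.adj_comm c a, G.adj_comm c b] at this
          tauto
        · have := nmC c hc d hd.2.2 a ha (Ne.symm hd.1) (Ne.symm hac) hd.2.1
          rw [G.adj_comm c a] at this
          tauto
        · have := nmC a ha d hd.2.2 c hc (Ne.symm hd.2.1) hac hd.1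
          rw [G.adj_comm a d] at this
          tauto

lemma triple [Finite V] [DecidableEq V] {G : SimpleGraph V} (hrob : Robust G)
    (hnored : ¬ ∃ V₀ : Finset V, ReducibleVertexSet G V₀) (w₁ w₂ w₃ : V) (h12 : G.Adj w₂ w₁)
    (h23 : G.Adj w₂ w₃) (h13 : w₁ ≠ w₃)
    (l1 : (G.neighborSet w₁).ncard ≤ 6) (l2 : (G.neighborSet w₂).ncard ≤ 6)
    (l3 : (G.neighborSet w₃).ncard ≤ 6) : False := by
  have := Fintype.ofFinite V
  have : DecidableRel G.Adj := Classical.decRel _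
  obtain ⟨d1, d2, q1⟩ := pair hrob hnored w₁ w₂ h12.symm l1 l2
  obtain ⟨-, d3, q3⟩ := pair hrob hnored w₂ w₃ h23 l2 l3
  have nm2 := nm hrob hnored w₂ l2
  rw [Set.ncard_eq_toFinset_card'] at d1 d2 d3
  have hR : (((G.neighborSet w₂).toFinset.erase w₁).erase w₃).card = 4 := by
    rw [Finset.card_erase_of_mem (by simp [h23, Ne.symm h13]), Finset.card_erase_of_mem (by simp [h12]), d2]
  have r1 : ∀ r, G.Adj w₂ r → r ≠ w₁ → r ≠ w₃ → G.Adj w₁ r := by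
    intro r hr n1 n3
    by_contra hn
    by_cases h : G.Adj w₁ w₃
    · rcases nm2 r w₁ w₃ hr h12 h23 n1 n3 h13 with h' | h'
      · exact hn h'.symm
      · exact hn (q3 w₁ r (Ne.symm n1) h12 h.symm hr h'.symm)
    · have := nm2 w₁ w₃ r h12 h23 hr h13 (Ne.symm n1) (Ne.symm n3)
      tauto
  have r3 : ∀ r, G.Adj w₂ r → r ≠ w₁ → r ≠ w₃ → G.Adj w₃ r := by
    intro r hr n1 n3
    by_contra hn
    by_cases h : G.Adj w₁ w₃
    · exact hn (q1 w₃ r (Ne.symm n3) h h23 (r1 r hr n1 n3) hr)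
    · have := nm2 w₃ w₁ r h23 h12 hr (Ne.symm h13) (Ne.symm n3) (Ne.symm n1)
      rw [G.adj_comm w₃ w₁] at this
      tauto
  obtain ⟨a, b, c, d, hnd, hm⟩ := ex4 _ hR
  simp only [Finset.mem_erase, List.mem_cons, List.not_mem_nil, or_false, Set.mem_toFinset,
    SimpleGraph.mem_neighborSet] at hm
  simp only [List.nodup_cons, List.mem_cons, List.not_mem_nil, or_false, not_or] at hnd
  have ha := (hm a).2 (by simp)
  have hb := (hm b).2 (by simp)
  have hc := (hm c).2 (by simp)
  have hd := (hm d).2 (by simp)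
  have hwc : ∀ w, (∀ r, G.Adj w₂ r → r ≠ w₁ → r ≠ w₃ → G.Adj w r) → G.Adj w w₂ →
      (G.neighborSet w).toFinset.card = 6 →
      ∃ o, ∀ u, G.Adj w u → u ∈ [w₂, a, b, c, d] ∨ u = o := by
    intro w hr hw2 h6
    have hs : ({w₂, a, b, c, d} : Finset V) ⊆ (G.neighborSet w).toFinset := by
      intro u hu
      simp only [Finset.mem_insert, Finset.mem_singleton] at hu
      simp only [Set.mem_toFinset, SimpleGraph.mem_neighborSet]
      grind
    have h5 : ({w₂, a, b, c, d} : Finset V).card = 5 := by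
      have := ha.2.2.ne
      have := hb.2.2.ne
      have := hc.2.2.ne
      have := hd.2.2.ne
      rw [Finset.card_insert_of_notMem, Finset.card_insert_of_notMem, Finset.card_insert_of_notMem,
        Finset.card_insert_of_notMem, Finset.card_singleton] <;>
        simp only [Finset.mem_insert, Finset.mem_singleton] <;> grind
    have h1 := Finset.card_sdiff_of_subset hs
    rw [h5, h6] at h1
    obtain ⟨o, ho⟩ := Finset.card_eq_one.1 h1
    refine ⟨o, fun u hu => ?_⟩
    by_contra hcon
    rw [not_or] at hcon
    have : u ∈ ((G.neighborSet w).toFinset \ {w₂, a, b, c, d}) := by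
      simp only [Finset.mem_sdiff, Set.mem_toFinset, SimpleGraph.mem_neighborSet, hu, true_and,
        Finset.mem_insert, Finset.mem_singleton]
      simpa using hcon.1
    rw [ho, Finset.mem_singleton] at this
    exact hcon.2 this
  obtain ⟨o₁, ho₁⟩ := hwc w₁ r1 h12.symm d1
  obtain ⟨o₃, ho₃⟩ := hwc w₃ r3 h23.symm d3
  have cl : ∀ x y, x ≠ w₃ ∧ x ≠ w₁ ∧ G.Adj w₂ x → y ≠ w₃ ∧ y ≠ w₁ ∧ G.Adj w₂ y → x ≠ y →
      G.Adj x y := by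
    intro x y hx hy hxy
    exact q1 x y hxy (r1 x hx.2.2 hx.2.1 hx.1) hx.2.2 (r1 y hy.2.2 hy.2.1 hy.1) hy.2.2
  have := h12.ne
  have := h23.ne
  refine triC hnored w₁ w₂ w₃ a b c d o₁ o₃ ?_ ?_ ho₁ ?_ ho₃ (cl _ _ ha hb (by grind))
    (cl _ _ ha hc (by grind)) (cl _ _ ha hd (by grind)) (cl _ _ hb hc (by grind))
    (cl _ _ hb hd (by grind)) (cl _ _ hc hd (by grind))
  · have := ha.2.2.ne
    have := hb.2.2.ne
    have := hc.2.2.ne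
    have := hd.2.2.ne
    simp only [List.nodup_cons, List.mem_cons, List.not_mem_nil, or_false, not_or]
    clear cl ho₁ ho₃ hwc r1 r3 q1 q3 nm2
    grind
  · simp only [List.mem_cons, List.not_mem_nil, or_false]
    grind
  · intro u hu
    have := hm u
    simp only [List.mem_cons, List.not_mem_nil, or_false]
    grind

/-! ### Systems of distinct representatives on five points -/

abbrev Tri := Fin 5 × Fin 5 × Fin 5

def tri5 : List Tri :=
  (List.finRange 5).flatMap fun c => (List.finRange 5).flatMap fun s =>
    ((List.finRange 5).filter fun t => decide (s < t ∧ c ≠ s ∧ c ≠ t)).map fun t => (c, s, t)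

def ei (s t : Fin 5) : ℕ := 5 + 5 * (min s t).val + (max s t).val

def useM (k : Tri) : ℕ := 2 ^ k.1.val ||| 2 ^ (ei k.2.1 k.2.2)

def badM (k : Tri) : ℕ := 2 ^ (ei k.1 k.2.1) ||| 2 ^ (ei k.1 k.2.2)

def avoid (L : List (Fin 5)) : List Tri :=
  tri5.filter fun k => decide (k.1 ∉ L ∧ k.2.1 ∉ L ∧ k.2.2 ∉ L)

def dat (L : List (Fin 5)) : List ℕ × List ℕ := ((avoid L).map badM, (avoid L).map useM)

def D0 : List ℕ × List ℕ :=
  ([192, 320, 384, 4160, 8256, 12288, 4224, 262272, 266240, 8448, 262400, 270336],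
    [4097, 8193, 262145, 130, 258, 262146, 68, 260, 8196, 72, 136, 4104])

def D4 : List (List ℕ × List ℕ) :=
 [([12288, 20480, 24576, 266240, 528384, 786432, 270336, 16785408, 17039360, 540672, 16793600, 17301504],
    [262146, 524290, 16777218, 8196, 16388, 16777220, 4104, 16392, 524296, 4112, 8208, 262160]),
  ([384, 640, 768, 262272, 524416, 786432, 262400, 16777472, 17039360, 524800, 16777728, 17301504],
    [262145, 524289, 16777217, 260, 516, 16777220, 136, 520, 524296, 144, 272, 262160]),
  ([320, 576, 768, 8256, 16448, 24576, 8448, 16777472, 16785408, 16896, 16777728, 16793600],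
    [8193, 16385, 16777217, 258, 514, 16777218, 72, 520, 16392, 80, 272, 8208]),
  ([192, 576, 640, 4160, 16448, 20480, 4224, 524416, 528384, 16896, 524800, 540672],
    [4097, 16385, 524289, 130, 514, 524290, 68, 516, 16388, 80, 144, 4112]),
  ([192, 320, 384, 4160, 8256, 12288, 4224, 262272, 266240, 8448, 262400, 270336],
    [4097, 8193, 262145, 130, 258, 262146, 68, 260, 8196, 72, 136, 4104])]

def D3 : List (List ℕ × List ℕ) :=
 [([786432, 17039360, 17301504],
    [16777220, 524296, 262160]),
  ([24576, 16785408, 16793600],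
    [16777218, 16392, 8208]),
  ([20480, 528384, 540672],
    [524290, 16388, 4112]),
  ([12288, 266240, 270336],
    [262146, 8196, 4104]),
  ([768, 16777472, 16777728],
    [16777217, 520, 272]),
  ([640, 524416, 524800],
    [524289, 516, 144]),
  ([384, 262272, 262400],
    [262145, 260, 136]),
  ([576, 16448, 16896],
    [16385, 514, 80]),
  ([320, 8256, 8448],
    [8193, 258, 72]),
  ([192, 4160, 4224],
    [4097, 130, 68])]

def pairs5 : List (Fin 5 × Fin 5) :=
  [(0, 1), (0, 2), (0, 3), (0, 4), (1, 2), (1, 3), (1, 4), (2, 3), (2, 4), (3, 4)]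

def EB : List ℕ := pairs5.map fun p => ei p.1 p.2

lemma D0_eq : D0 = dat [4] := by decide +kernel
lemma D4_eq : D4 = (List.finRange 5).map fun p => dat [p] := by decide +kernel
lemma D3_eq : D3 = pairs5.map fun p => dat [p.1, p.2] := by decide +kernel

def isBad (m : ℕ) : List ℕ → Bool
  | [] => false
  | q :: qs => Nat.beq (Nat.land m q) q || isBad m qs

def tryAll (used : ℕ) (k : ℕ → Bool) : List ℕ → Bool
  | [] => false
  | u :: us => (Nat.beq (Nat.land used u) 0 && k (Nat.lor used u)) || tryAll used k us

def chk8 (m : ℕ) : Bool :=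
  isBad m D0.1 || D4.all fun d2 => isBad m d2.1 || D4.all fun d3 => isBad m d3.1 ||
    D3.all fun d0 => isBad m d0.1 ||
      tryAll m (fun m => tryAll m (fun m => tryAll m (fun m => tryAll m (fun _ => true) d3.2) d2.2)
        D0.2) d0.2

lemma chk8_ok : enum [6, 7, 8, 9, 12, 13, 14, 18, 19, 24] 0 chk8 = true := by decide +kernel

def chk9 : Bool :=
  (List.finRange 5).all fun p => (List.finRange 5).all fun p' => D3.all fun d0 =>
    (List.finRange 5).any fun z => decide (z ≠ 4 ∧ z ≠ p) &&
      tryAll 0 (fun m => tryAll m (fun m => tryAll m (fun m => tryAll m (fun _ => true)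
        (dat [p']).2) (dat [p, z]).2) (dat [4, z]).2) d0.2

lemma chk9_ok : chk9 = true := by decide +kernel

lemma isBad_iff (m : ℕ) : ∀ l, isBad m l = true → ∃ q ∈ l, m &&& q = q := by
  intro l
  induction l with
  | nil => simp [isBad]
  | cons q qs ih =>
    intro h
    simp only [isBad, Bool.or_eq_true] at h
    rcases h with h | h
    · exact ⟨q, by simp, Nat.eq_of_beq_eq_true h⟩
    · obtain ⟨r, hr, h⟩ := ih h
      exact ⟨r, by simp [hr], h⟩

lemma of_tryAll (m : ℕ) (k : ℕ → Bool) : ∀ l, tryAll m k l = true →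
    ∃ u ∈ l, m &&& u = 0 ∧ k (m ||| u) = true := by
  intro l
  induction l with
  | nil => simp [tryAll]
  | cons q qs ih =>
    intro h
    simp only [tryAll, Bool.or_eq_true, Bool.and_eq_true] at h
    rcases h with h | h
    · exact ⟨q, by simp, Nat.eq_of_beq_eq_true h.1, h.2⟩
    · obtain ⟨r, hr, h⟩ := ih h
      exact ⟨r, by simp [hr], h⟩

lemma ei_comm (s t : Fin 5) : ei s t = ei t s := by
  unfold ei; rw [min_comm, max_comm]

lemma mem_tri5 : ∀ k : Tri, k ∈ tri5 ↔ k.2.1 < k.2.2 ∧ k.1 ≠ k.2.1 ∧ k.1 ≠ k.2.2 := by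
  decide +kernel

lemma mem_avoid (L : List (Fin 5)) (k : Tri) : k ∈ avoid L ↔
    (k.2.1 < k.2.2 ∧ k.1 ≠ k.2.1 ∧ k.1 ≠ k.2.2) ∧ k.1 ∉ L ∧ k.2.1 ∉ L ∧ k.2.2 ∉ L := by
  rw [avoid, List.mem_filter, mem_tri5, decide_eq_true_eq]

lemma and_zero_bit {a b : ℕ} (h : a &&& b = 0) (j : ℕ) (ha : a.testBit j = true)
    (hb : b.testBit j = true) : False := by
  have : (a &&& b).testBit j = true := by rw [Nat.testBit_and, ha, hb]; rfl
  rw [h] at this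
  simp at this

lemma useM_bit1 (k : Tri) : (useM k).testBit k.1.val = true := by
  simp [useM, Nat.testBit_or, Nat.testBit_two_pow]

lemma useM_bit2 (k : Tri) : (useM k).testBit (ei k.2.1 k.2.2) = true := by
  simp [useM, Nat.testBit_or, Nat.testBit_two_pow]

lemma use_disj {k k' : Tri} (h : useM k &&& useM k' = 0) : k.1 ≠ k'.1 ∧ k.2 ≠ k'.2 := by
  constructor
  · intro he
    exact and_zero_bit h _ (useM_bit1 k) (by rw [he]; exact useM_bit1 k')
  · intro he
    exact and_zero_bit h _ (useM_bit2 k) (by rw [he]; exact useM_bit2 k')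

/-- The four choices are compatible. -/
def Compat (k : Fin 4 → Tri) : Prop :=
  ∀ i j, i ≠ j → (k i).1 ≠ (k j).1 ∧ (k i).2 ≠ (k j).2

lemma or_and_zero {a b c : ℕ} (h : (a ||| b) &&& c = 0) : a &&& c = 0 ∧ b &&& c = 0 := by
  rw [Nat.and_or_distrib_right, Nat.or_eq_zero_iff] at h
  exact h

lemma four {m u0 u1 u2 u3 : ℕ} (h0 : m &&& u0 = 0) (h1 : (m ||| u0) &&& u1 = 0)
    (h2 : (m ||| u0 ||| u1) &&& u2 = 0) (h3 : (m ||| u0 ||| u1 ||| u2) &&& u3 = 0) :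
    (m &&& u0 = 0 ∧ m &&& u1 = 0 ∧ m &&& u2 = 0 ∧ m &&& u3 = 0) ∧
    u0 &&& u1 = 0 ∧ u0 &&& u2 = 0 ∧ u0 &&& u3 = 0 ∧ u1 &&& u2 = 0 ∧ u1 &&& u3 = 0 ∧
      u2 &&& u3 = 0 := by
  have a1 := or_and_zero h1
  have a2 := or_and_zero h2
  have a2' := or_and_zero a2.1
  have a3 := or_and_zero h3
  have a3' := or_and_zero a3.1
  have a3'' := or_and_zero a3'.1
  tauto

lemma compat_of {k0 k1 k2 k3 : Tri}
    (h : useM k0 &&& useM k1 = 0 ∧ useM k0 &&& useM k2 = 0 ∧ useM k0 &&& useM k3 = 0 ∧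
      useM k1 &&& useM k2 = 0 ∧ useM k1 &&& useM k3 = 0 ∧ useM k2 &&& useM k3 = 0) :
    Compat ![k1, k2, k3, k0] := by
  obtain ⟨h01, h02, h03, h12, h13, h23⟩ := h
  have e01 := use_disj h01
  have e02 := use_disj h02
  have e03 := use_disj h03
  have e12 := use_disj h12
  have e13 := use_disj h13
  have e23 := use_disj h23
  intro i j hij
  fin_cases i <;> fin_cases j <;> first | exact absurd rfl hij | assumption |
    exact ⟨Ne.symm (by first | exact e01.1 | exact e02.1 | exact e03.1 | exact e12.1 | exact e13.1 | exact e23.1),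
      Ne.symm (by first | exact e01.2 | exact e02.2 | exact e03.2 | exact e12.2 | exact e13.2 | exact e23.2)⟩

lemma mem_pairs5 : ∀ p q : Fin 5, p < q → (p, q) ∈ pairs5 := by decide

lemma sdr8 (N : Fin 5 → Fin 5 → Prop) (hN : ∀ s t, N s t → N t s) (p p' q q' : Fin 5) (hq : q < q')
    (g : ∀ L ∈ [[4], [p], [p'], [q, q']], ∀ a b c, a ∉ L → b ∉ L → c ∉ L → a ≠ b → a ≠ c → b ≠ c →
      ¬ N a b ∨ ¬ N a c) :
    ∃ k : Fin 4 → Tri, Compat k ∧ (∀ i, ¬ N (k i).2.1 (k i).2.2) ∧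
      ∀ i, k i ∈ avoid (![[4], [p], [p'], [q, q']] i) := by
  classical
  let gg : ℕ → Bool := fun j => decide (∃ s t : Fin 5, j = ei s t ∧ N s t)
  set m := build gg [6, 7, 8, 9, 12, 13, 14, 18, 19, 24] 0 with hm
  have hmem : ∀ s t : Fin 5, s ≠ t → ei s t ∈ [6, 7, 8, 9, 12, 13, 14, 18, 19, 24] := by
    decide
  have hinj : ∀ s t s' t' : Fin 5, ei s t = ei s' t' → (s = s' ∧ t = t') ∨ (s = t' ∧ t = s') := by
    decide +kernel
  have bit : ∀ s t, s ≠ t → (m.testBit (ei s t) = true ↔ N s t) := by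
    intro s t hst
    rw [hm, testBit_build]
    simp only [Nat.zero_testBit, Bool.false_or, hmem s t hst, decide_true, Bool.true_and, gg,
      decide_eq_true_eq]
    constructor
    · rintro ⟨s', t', he, h⟩
      rcases hinj _ _ _ _ he with ⟨rfl, rfl⟩ | ⟨rfl, rfl⟩
      · exact h
      · exact hN _ _ h
    · intro h
      exact ⟨s, t, rfl, h⟩
  have notbad : ∀ L ∈ [[4], [p], [p'], [q, q']], isBad m (dat L).1 = false := by
    intro L hL
    by_contra hb
    rw [Bool.not_eq_false] at hb
    obtain ⟨r, hr, h⟩ := isBad_iff _ _ hb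
    simp only [dat, List.mem_map] at hr
    obtain ⟨⟨a, b, c⟩, hk, rfl⟩ := hr
    rw [mem_avoid] at hk
    obtain ⟨⟨h1, h2, h3⟩, h4, h5, h6⟩ := hk
    have hb : ∀ j, (badM (a, b, c)).testBit j = true → m.testBit j = true := by
      intro j hj
      rw [← h, Nat.testBit_and] at hj
      exact (Bool.and_eq_true _ _ ▸ hj).1
    have e1 := (bit a b h2).1 (hb _ (by simp [badM, Nat.testBit_or, Nat.testBit_two_pow]))
    have e2 := (bit a c h3).1 (hb _ (by simp [badM, Nat.testBit_or, Nat.testBit_two_pow]))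
    have := g L hL a b c h4 h5 h6 h2 h3 h1.ne
    tauto
  have hc := enum_build gg chk8 _ _ chk8_ok
  rw [← hm] at hc
  simp only [chk8, D0_eq, notbad [4] (by simp), Bool.false_or, List.all_eq_true] at hc
  have hc := hc (dat [p]) (by rw [D4_eq]; exact List.mem_map_of_mem (f := fun p => dat [p]) (List.mem_finRange p))
  rw [notbad [p] (by simp), Bool.false_or, List.all_eq_true] at hc
  have hc := hc (dat [p']) (by rw [D4_eq]; exact List.mem_map_of_mem (f := fun p => dat [p]) (List.mem_finRange p'))
  rw [notbad [p'] (by simp), Bool.false_or, List.all_eq_true] at hc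
  have hc := hc (dat [q, q']) (by
    rw [D3_eq]
    exact List.mem_map_of_mem (f := fun p : Fin 5 × Fin 5 => dat [p.1, p.2]) (mem_pairs5 q q' hq))
  rw [notbad [q, q'] (by simp), Bool.false_or] at hc
  obtain ⟨u0, m0, h0, hc⟩ := of_tryAll _ _ _ hc
  obtain ⟨u1, m1, h1, hc⟩ := of_tryAll _ _ _ hc
  obtain ⟨u2, m2, h2, hc⟩ := of_tryAll _ _ _ hc
  obtain ⟨u3, m3, h3, -⟩ := of_tryAll _ _ _ hc
  simp only [dat, List.mem_map] at m0 m1 m2 m3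
  obtain ⟨k0, m0, rfl⟩ := m0
  obtain ⟨k1, m1, rfl⟩ := m1
  obtain ⟨k2, m2, rfl⟩ := m2
  obtain ⟨k3, m3, rfl⟩ := m3
  obtain ⟨hm0, hd⟩ := four h0 h1 h2 h3
  have na : ∀ k : Tri, ∀ L, k ∈ avoid L → m &&& useM k = 0 → ¬ N k.2.1 k.2.2 := by
    intro k L hk h hn
    rw [mem_avoid] at hk
    exact and_zero_bit h _ ((bit _ _ hk.1.1.ne).2 hn) (useM_bit2 k)
  refine ⟨![k1, k2, k3, k0], compat_of hd, ?_, ?_⟩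
  · intro i
    fin_cases i
    · exact na _ _ m1 hm0.2.1
    · exact na _ _ m2 hm0.2.2.1
    · exact na _ _ m3 hm0.2.2.2
    · exact na _ _ m0 hm0.1
  · intro i
    fin_cases i
    · exact m1
    · exact m2
    · exact m3
    · exact m0

lemma sdr9 (p p' q q' : Fin 5) (hq : q < q') :
    ∃ z : Fin 5, z ≠ 4 ∧ z ≠ p ∧ ∃ k : Fin 4 → Tri, Compat k ∧
      ∀ i, k i ∈ avoid (![[4, z], [p, z], [p'], [q, q']] i) := by
  have hc := chk9_ok
  simp only [chk9, List.all_eq_true, List.any_eq_true] at hc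
  obtain ⟨z, -, hc⟩ := hc p (List.mem_finRange p) p' (List.mem_finRange p') (dat [q, q']) (by
    rw [D3_eq]
    exact List.mem_map_of_mem (f := fun p : Fin 5 × Fin 5 => dat [p.1, p.2]) (mem_pairs5 q q' hq))
  rw [Bool.and_eq_true, decide_eq_true_eq] at hc
  obtain ⟨hz, hc⟩ := hc
  obtain ⟨u0, m0, h0, hc⟩ := of_tryAll _ _ _ hc
  obtain ⟨u1, m1, h1, hc⟩ := of_tryAll _ _ _ hc
  obtain ⟨u2, m2, h2, hc⟩ := of_tryAll _ _ _ hc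
  obtain ⟨u3, m3, h3, -⟩ := of_tryAll _ _ _ hc
  simp only [dat, List.mem_map] at m0 m1 m2 m3
  obtain ⟨k0, m0, rfl⟩ := m0
  obtain ⟨k1, m1, rfl⟩ := m1
  obtain ⟨k2, m2, rfl⟩ := m2
  obtain ⟨k3, m3, rfl⟩ := m3
  obtain ⟨hm0, hd⟩ := four h0 h1 h2 h3
  refine ⟨z, hz.1, hz.2, ![k1, k2, k3, k0], compat_of hd, ?_⟩
  intro i
  fin_cases i
  · exact m1
  · exact m2
  · exact m3
  · exact m0

/-! ### The main configuration -/

abbrev Vx := Fin 4 ⊕ Option (Fin 5)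

def tr (k : Fin 4 → Tri) (z : Fin 5) (e : ℕ) : (Fin 4 × Bool) ⊕ Fin e → Finset Vx
  | .inl (i, true) => {.inl i, .inr none, .inr (some (k i).1)}
  | .inl (i, false) => {.inl i, .inr (some (k i).2.1), .inr (some (k i).2.2)}
  | .inr _ => {.inl 0, .inl 1, .inr (some z)}

lemma tr_disj (k : Fin 4 → Tri) (z : Fin 5) (e : ℕ) (he : e ≤ 1) (hk : Compat k)
    (hkt : ∀ i, (k i).2.1 < (k i).2.2 ∧ (k i).1 ≠ (k i).2.1 ∧ (k i).1 ≠ (k i).2.2)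
    (hz : e = 1 → ∀ i : Fin 4, i = 0 ∨ i = 1 → z ≠ (k i).1 ∧ z ≠ (k i).2.1 ∧ z ≠ (k i).2.2) :
    ∀ a b, a ≠ b → (tr k z e a ∩ tr k z e b).card ≤ 1 := by
  have main : ∀ (i : Fin 4) (r : Fin e) (s : Bool),
      (tr k z e (.inr r) ∩ tr k z e (.inl (i, s))).card ≤ 1 := by
    intro i r s
    have h1 : e = 1 := by have := r.2; omega
    have hz := hz h1 i
    rw [Finset.card_le_one]
    cases s <;> simp only [tr, Finset.mem_inter, Finset.mem_insert, Finset.mem_singleton] <;>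
      grind
  have tf : ∀ (i j : Fin 4),
      (tr k z e (.inl (i, true)) ∩ tr k z e (.inl (j, false))).card ≤ 1 := by
    intro i j
    have hi := hkt i
    have hj := hkt j
    rw [Finset.card_le_one]
    simp only [tr, Finset.mem_inter, Finset.mem_insert, Finset.mem_singleton]
    grind
  have tt : ∀ (i j : Fin 4), i ≠ j →
      (tr k z e (.inl (i, true)) ∩ tr k z e (.inl (j, true))).card ≤ 1 := by
    intro i j hij
    have h := hk i j hij
    rw [Finset.card_le_one]
    simp only [tr, Finset.mem_inter, Finset.mem_insert, Finset.mem_singleton]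
    grind
  have ff : ∀ (i j : Fin 4), i ≠ j →
      (tr k z e (.inl (i, false)) ∩ tr k z e (.inl (j, false))).card ≤ 1 := by
    intro i j hij
    have h := (hk i j hij).2
    have hi := (hkt i).1
    have hj := (hkt j).1
    rw [Ne, Prod.ext_iff] at h
    rw [Finset.card_le_one]
    simp only [tr, Finset.mem_inter, Finset.mem_insert, Finset.mem_singleton]
    grind
  rintro (⟨i, s⟩ | r) (⟨j, t⟩ | r') hne
  · cases s <;> cases t
    · exact ff i j (by grind)
    · rw [Finset.inter_comm]; exact tf j i
    · exact tf i j
    · exact tt i j (by grind)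
  · rw [Finset.inter_comm]; exact main i r' s
  · exact main j r t
  · exfalso
    apply hne
    congr 1
    ext
    omega

lemma red_main [DecidableEq V] {G : SimpleGraph V}
    (hnored : ¬ ∃ V₀ : Finset V, ReducibleVertexSet G V₀) (w : Fin 4 → V) (v : V) (u : Fin 5 → V)
    (hinj : Function.Injective (Sum.elim w (fun o : Option (Fin 5) => o.elim v u)))
    (hvw : ∀ i, G.Adj (w i) v) (hvu : ∀ j, G.Adj v (u j))
    (k : Fin 4 → Tri) (hk : Compat k)
    (hkt : ∀ i, (k i).2.1 < (k i).2.2 ∧ (k i).1 ≠ (k i).2.1 ∧ (k i).1 ≠ (k i).2.2)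
    (hkw : ∀ i, G.Adj (w i) (u (k i).1) ∧ G.Adj (w i) (u (k i).2.1) ∧ G.Adj (w i) (u (k i).2.2))
    (hks : ∀ i, G.Adj (u (k i).2.1) (u (k i).2.2))
    (EX KX : Finset (Sym2 V))
    (hN : ∀ i x, G.Adj (w i) x → x = v ∨ (∃ j, u j = x) ∨ s(w i, x) ∈ EX)
    (hKX : ∀ a b, (a = v ∨ ∃ j, u j = a) → (b = v ∨ ∃ j, u j = b) → G.Adj a b → s(a, b) ∈ KX)
    (e : ℕ) (he : e ≤ 1) (z : Fin 5)
    (hz : e = 1 → (G.Adj (w 0) (w 1) ∧ G.Adj (w 0) (u z) ∧ G.Adj (w 1) (u z)) ∧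
      ∀ i : Fin 4, i = 0 ∨ i = 1 → z ≠ (k i).1 ∧ z ≠ (k i).2.1 ∧ z ≠ (k i).2.2)
    (hcard : KX.card + EX.card ≤ 2 * (8 + e)) : False := by
  set f : Vx → V := Sum.elim w (fun o : Option (Fin 5) => o.elim v u) with hf
  have hcl : ∀ i, G.IsNClique 3 ((tr k z e i).image f) := by
    rintro (⟨i, s⟩ | r)
    · cases s
      · simp only [tr, Finset.image_insert, Finset.image_singleton]
        exact SimpleGraph.is3Clique_iff.2 ⟨_, _, _, (hkw i).2.1, (hkw i).2.2, hks i, rfl⟩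
      · simp only [tr, Finset.image_insert, Finset.image_singleton]
        exact SimpleGraph.is3Clique_iff.2 ⟨_, _, _, hvw i, (hkw i).1, hvu _, rfl⟩
    · have h1 : e = 1 := by have := r.2; omega
      simp only [tr, Finset.image_insert, Finset.image_singleton]
      obtain ⟨⟨h1, h2, h3⟩, -⟩ := hz h1
      exact SimpleGraph.is3Clique_iff.2 ⟨_, _, _, h1, h2, h3, rfl⟩
  refine red_fam hnored (fun i => (tr k z e i).image f) hcl ?_ (Finset.univ.image w) (by simp)
    (KX ∪ EX) ?_ ?_ ?_
  · intro i j hij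
    rw [← Finset.image_inter _ _ hinj]
    exact Finset.card_image_le.trans (tr_disj k z e he hk hkt (fun h => (hz h).2) i j hij)
  · refine (Finset.card_union_le _ _).trans (hcard.trans ?_)
    simp
  · intro x hx a b ha hb hab
    obtain ⟨i, -, rfl⟩ := Finset.mem_image.1 hx
    simp only [Finset.mem_union]
    rcases or_assoc.2 (hN i a ha) with h1 | h1
    · rcases or_assoc.2 (hN i b hb) with h2 | h2
      · exact Or.inr (Or.inr (Or.inl (hKX a b h1 h2 hab)))
      · exact Or.inr (Or.inl (Or.inr h2))
    · exact Or.inl (Or.inr h1)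
  · intro i a ha b hb hab ha' hb'
    have hadj := (hcl i).1 ha hb hab
    have hK : ∀ a, a ∈ (tr k z e i).image f → a ∉ Finset.univ.image w → a = v ∨ ∃ j, u j = a := by
      intro a ha hna
      obtain ⟨x, -, rfl⟩ := Finset.mem_image.1 ha
      rcases x with i | (_ | j)
      · exact absurd (Finset.mem_image_of_mem w (Finset.mem_univ i)) hna
      · left; rfl
      · right; exact ⟨j, rfl⟩
    exact Finset.mem_union_left _ (hKX a b (hK a ha ha') (hK b hb hb') hadj)

lemma small1 : ∀ S : Finset (Fin 5), S.card ≤ 1 → ∃ p, S ⊆ {p} := by decide +kernel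
lemma small2 : ∀ S : Finset (Fin 5), S.card ≤ 2 → ∃ q q', q < q' ∧ S ⊆ {q, q'} := by
  decide +kernel

lemma kx15 [DecidableEq V] {G : SimpleGraph V} (v : V) (u : Fin 5 → V) :
    ∃ KX : Finset (Sym2 V), KX.card ≤ 15 ∧
      ∀ a b, (a = v ∨ ∃ j, u j = a) → (b = v ∨ ∃ j, u j = b) → G.Adj a b → s(a, b) ∈ KX := by
  let κ : Fin 6 → V := Fin.cons v u
  refine ⟨(allPairs.map fun p => s(κ p.1, κ p.2)).toFinset, ?_, ?_⟩
  · exact (List.toFinset_card_le _).trans (by simp [allPairs])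
  · have hκ : ∀ a, (a = v ∨ ∃ j, u j = a) → ∃ i, κ i = a := by
      rintro a (rfl | ⟨j, rfl⟩)
      · exact ⟨0, rfl⟩
      · exact ⟨j.succ, rfl⟩
    intro a b ha hb hab
    obtain ⟨i, rfl⟩ := hκ a ha
    obtain ⟨j, rfl⟩ := hκ b hb
    rw [List.mem_toFinset, List.mem_map]
    rcases lt_trichotomy i j with h | h | h
    · exact ⟨_, mem_allPairs i j h, rfl⟩
    · subst h; exact absurd rfl hab.ne
    · exact ⟨_, mem_allPairs j i h, Sym2.eq_swap⟩

lemma kx14 [DecidableEq V] {G : SimpleGraph V} (v : V) (u : Fin 5 → V) (hu : Function.Injective u)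
    (hv : ∀ j, u j ≠ v) (s t : Fin 5) (hst : s ≠ t) (hn : ¬ G.Adj (u s) (u t)) :
    ∃ KX : Finset (Sym2 V), KX.card ≤ 14 ∧
      ∀ a b, (a = v ∨ ∃ j, u j = a) → (b = v ∨ ∃ j, u j = b) → G.Adj a b → s(a, b) ∈ KX := by
  classical
  obtain ⟨KX, h1, h2⟩ := kx15 (G := G) v u
  obtain ⟨KX', h1', h2'⟩ := kx15 (G := (⊤ : SimpleGraph V)) v u
  refine ⟨KX'.erase s(u s, u t), ?_, ?_⟩
  · have := h2' (u s) (u t) (Or.inr ⟨s, rfl⟩) (Or.inr ⟨t, rfl⟩) (fun h => hst (hu h))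
    rw [Finset.card_erase_of_mem this]
    omega
  · intro a b ha hb hab
    rw [Finset.mem_erase]
    refine ⟨?_, h2' a b ha hb hab.ne⟩
    intro h
    rw [← SimpleGraph.mem_edgeSet, h] at hab
    exact hn hab

set_option maxHeartbeats 1000000 in
lemma core [Finite V] [DecidableEq V] {G : SimpleGraph V} (hrob : Robust G)
    (hnored : ¬ ∃ V₀ : Finset V, ReducibleVertexSet G V₀) (v : V)
    (hv : (G.neighborSet v).ncard = 9) (w : Fin 4 → V) (hw : Function.Injective w)
    (hlow : ∀ i, (G.neighborSet (w i)).ncard ≤ 6) (hvw : ∀ i, G.Adj (w i) v)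
    (hsub : ∀ i, i ≠ 3 → ∀ x, G.Adj (w i) x → x = v ∨ G.Adj v x)
    (hp : (∀ i j, i ≠ 3 → j ≠ 3 → ¬ G.Adj (w i) (w j)) ∨ G.Adj (w 0) (w 1)) : False := by
  have := Fintype.ofFinite V
  have : DecidableRel G.Adj := Classical.decRel _
  have htri : ∀ i j j', G.Adj (w i) (w j) → G.Adj (w i) (w j') → j = j' := by
    intro i j j' h h'
    by_contra hne
    exact triple hrob hnored (w j) (w i) (w j') h h' (fun e => hne (hw e)) (hlow _) (hlow _)
      (hlow _)
  set U : Finset V := (G.neighborSet v).toFinset \ Finset.univ.image w with hU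
  have hUc : U.card = 5 := by
    rw [hU, Finset.card_sdiff_of_subset, Finset.card_image_of_injective _ hw, ← Set.ncard_eq_toFinset_card', hv]
    · simp
    · intro x hx
      obtain ⟨i, -, rfl⟩ := Finset.mem_image.1 hx
      simpa using (hvw i).symm
  have mU : ∀ x, x ∈ U ↔ G.Adj v x ∧ ∀ i, w i ≠ x := by
    intro x; simp [hU]
  let R : Fin 4 → Finset V := fun i => (G.neighborSet (w i)).toFinset \ insert v U
  have mR : ∀ i x, x ∈ R i ↔ G.Adj (w i) x ∧ x ≠ v ∧ (G.Adj v x → ∃ j, w j = x) := by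
    intro i x
    simp only [R, Finset.mem_sdiff, Set.mem_toFinset, SimpleGraph.mem_neighborSet,
      Finset.mem_insert, mU, not_or, not_and, not_forall, not_not]
  have RW : ∀ i, i ≠ 3 → ∀ x ∈ R i, ∃ j, w j = x := by
    intro i hi x hx
    rw [mR] at hx
    exact hx.2.2 ((hsub i hi x hx.1).resolve_left hx.2.1)
  have R1 : ∀ i, (R i).card ≤ 1 := by
    intro i
    have key : ∀ x y, x ∈ R i → y ∈ R i → x ≠ y → ¬ G.Adj v x → False := by
      intro x y hx hy hxy hn
      have hi : i = 3 := by
        by_contra hi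
        obtain ⟨j, rfl⟩ := RW i hi x hx
        exact hn (hvw j).symm
      subst hi
      rw [mR] at hx hy
      by_cases hy' : G.Adj v y
      · obtain ⟨j, rfl⟩ := hy.2.2 hy'
        have hj : j ≠ 3 := by rintro rfl; exact hy.1.ne rfl
        rcases nm hrob hnored (w 3) (hlow 3) x v (w j) hx.1 (hvw 3) hy.1 hx.2.1 hxy
          (Ne.symm hy.2.1) with h | h
        · exact hn h.symm
        · have := hsub j hj x h.symm
          tauto
      · have := nm hrob hnored (w 3) (hlow 3) v x y (hvw 3) hx.1 hy.1 (Ne.symm hx.2.1)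
          (Ne.symm hy.2.1) hxy
        tauto
    rw [Finset.card_le_one]
    intro x hx y hy
    by_contra hxy
    by_cases h1 : G.Adj v x
    · by_cases h2 : G.Adj v y
      · rw [mR] at hx hy
        obtain ⟨j, rfl⟩ := hx.2.2 h1
        obtain ⟨j', rfl⟩ := hy.2.2 h2
        exact hxy (congrArg w (htri i j j' hx.1 hy.1))
      · exact key y x hy hx (Ne.symm hxy) h2
    · exact key x y hx hy hxy h1
  have HA : ∀ u : Fin 5 → V, Function.Injective u → (∀ x, x ∈ U ↔ ∃ j, u j = x) →
      (∀ i, i ≠ 3 → ∃ p, ∀ j, j ≠ p → G.Adj (w i) (u j)) ∧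
      ∃ q q', q < q' ∧ ∀ j, j ≠ q → j ≠ q' → G.Adj (w 3) (u j) := by
    intro u hu hr
    have cnt : ∀ i, (G.neighborSet (w i)).ncard ≤
        1 + (Finset.univ.filter fun j => G.Adj (w i) (u j)).card + (R i).card := by
      intro i
      rw [Set.ncard_eq_toFinset_card']
      have hs : (G.neighborSet (w i)).toFinset ⊆
          ({v} ∪ (Finset.univ.filter fun j => G.Adj (w i) (u j)).image u) ∪ R i := by
        intro x hx
        have hx' : G.Adj (w i) x := by simpa using hx
        by_cases h : x ∈ insert v U
        · apply Finset.mem_union_left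
          rw [Finset.mem_insert] at h
          rcases h with rfl | h
          · simp
          · obtain ⟨j, rfl⟩ := (hr x).1 h
            apply Finset.mem_union_right
            exact Finset.mem_image_of_mem _ (by simpa using hx')
        · exact Finset.mem_union_right _ (Finset.mem_sdiff.2 ⟨hx, h⟩)
      refine (Finset.card_le_card hs).trans ((Finset.card_union_le _ _).trans ?_)
      have h1 := Finset.card_union_le {v} ((Finset.univ.filter fun j => G.Adj (w i) (u j)).image u)
      have h2 := Finset.card_image_le (s := Finset.univ.filter fun j => G.Adj (w i) (u j)) (f := u)
      rw [Finset.card_singleton] at h1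
      omega
    have cpl : ∀ i, (Finset.univ.filter fun j => G.Adj (w i) (u j)).card +
        (Finset.univ.filter fun j => ¬ G.Adj (w i) (u j)).card = 5 := by
      intro i
      rw [Finset.card_filter_add_card_filter_not]
      simp
    constructor
    · intro i hi
      have hle : (Finset.univ.filter fun j => ¬ G.Adj (w i) (u j)).card ≤ 1 := by
        have h1 := cnt i
        have h2 := cpl i
        have h3 := R1 i
        have h4 := deg5 hrob hnored (w i)
        rcases Nat.eq_zero_or_pos (R i).card with h | h
        · omega
        · obtain ⟨x, hx⟩ := Finset.card_pos.1 h
          obtain ⟨j, rfl⟩ := RW i hi x hx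
          rw [mR] at hx
          have := (pair hrob hnored (w i) (w j) hx.1 (hlow i) (hlow j)).1
          omega
      obtain ⟨p, hp⟩ := small1 _ hle
      refine ⟨p, fun j hj => ?_⟩
      by_contra hn
      have := hp (Finset.mem_filter.2 ⟨Finset.mem_univ j, hn⟩)
      exact hj (by simpa using this)
    · have hle : (Finset.univ.filter fun j => ¬ G.Adj (w 3) (u j)).card ≤ 2 := by
        have h1 := cnt 3
        have h2 := cpl 3
        have h3 := R1 3
        have h4 := deg5 hrob hnored (w 3)
        omega
      obtain ⟨q, q', hqq, hp⟩ := small2 _ hle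
      refine ⟨q, q', hqq, fun j hj hj' => ?_⟩
      by_contra hn
      have := hp (Finset.mem_filter.2 ⟨Finset.mem_univ j, hn⟩)
      simp only [Finset.mem_insert, Finset.mem_singleton] at this
      tauto
  obtain ⟨u0, hu0, hr0⟩ : ∃ u : Fin 5 → V, Function.Injective u ∧ ∀ x, x ∈ U ↔ ∃ j, u j = x := by
    let e := (U.equivFinOfCardEq hUc).symm
    refine ⟨fun j => (e j).1, fun a b h => e.injective (Subtype.ext h), fun x => ?_⟩
    constructor
    · intro hx
      exact ⟨e.symm ⟨x, hx⟩, by simp⟩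
    · rintro ⟨j, rfl⟩
      exact (e j).2
  obtain ⟨p0, hp0⟩ := (HA u0 hu0 hr0).1 0 (by decide)
  obtain ⟨u, hu, hr, hB0⟩ : ∃ u : Fin 5 → V, Function.Injective u ∧ (∀ x, x ∈ U ↔ ∃ j, u j = x) ∧
      ∀ j, j ≠ 4 → G.Adj (w 0) (u j) := by
    refine ⟨u0 ∘ Equiv.swap p0 4, hu0.comp (Equiv.injective _), fun x => ?_, fun j hj => ?_⟩
    · rw [hr0]
      constructor
      · rintro ⟨j, rfl⟩
        exact ⟨Equiv.swap p0 4 j, by simp⟩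
      · rintro ⟨j, rfl⟩
        exact ⟨_, rfl⟩
    · apply hp0
      intro h
      rw [Equiv.swap_apply_eq_iff, Equiv.swap_apply_left] at h
      exact hj h
  obtain ⟨HA1, q, q', hqq, hB3⟩ := HA u hu hr
  obtain ⟨p, hB1⟩ := HA1 1 (by decide)
  obtain ⟨p', hB2⟩ := HA1 2 (by decide)
  have huU : ∀ j, G.Adj v (u j) ∧ ∀ i, w i ≠ u j := fun j => (mU _).1 ((hr _).2 ⟨j, rfl⟩)
  have hinj : Function.Injective (Sum.elim w (fun o : Option (Fin 5) => o.elim v u)) := by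
    rintro (i | (_ | j)) (i' | (_ | j')) h
    · exact congrArg _ (hw h)
    · exact absurd h (hvw i).ne
    · exact absurd h ((huU j').2 i)
    · exact absurd h.symm (hvw i').ne
    · rfl
    · exact absurd h (huU j').1.ne
    · exact absurd h.symm ((huU j).2 i')
    · exact absurd h.symm (huU j).1.ne
    · exact congrArg _ (congrArg _ (hu h))
  have hBB : ∀ i : Fin 4, ∀ j, j ∉ ![[4], [p], [p'], [q, q']] i → G.Adj (w i) (u j) := by
    intro i j
    fin_cases i
    · simpa using hB0 j
    · simpa using hB1 j
    · simpa using hB2 j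
    · simpa using hB3 j
  -- system for eight triangles
  have S8 : ∃ k : Fin 4 → Tri, Compat k ∧
      (∀ i, (k i).2.1 < (k i).2.2 ∧ (k i).1 ≠ (k i).2.1 ∧ (k i).1 ≠ (k i).2.2) ∧
      (∀ i, G.Adj (w i) (u (k i).1) ∧ G.Adj (w i) (u (k i).2.1) ∧ G.Adj (w i) (u (k i).2.2)) ∧
      (∀ i, G.Adj (u (k i).2.1) (u (k i).2.2)) := by
    obtain ⟨k, h1, h2, h3⟩ := sdr8 (fun s t => ¬ G.Adj (u s) (u t)) (fun s t h h' => h h'.symm)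
      p p' q q' hqq (by
        have : ∀ i : Fin 4, ∀ a b c, a ∉ ![[4], [p], [p'], [q, q']] i →
            b ∉ ![[4], [p], [p'], [q, q']] i → c ∉ ![[4], [p], [p'], [q, q']] i →
            a ≠ b → a ≠ c → b ≠ c → ¬ ¬ G.Adj (u a) (u b) ∨ ¬ ¬ G.Adj (u a) (u c) := by
          intro i a b c ha hb hc hab hac hbc
          rw [not_not, not_not]
          exact nm hrob hnored (w i) (hlow i) _ _ _ (hBB i a ha) (hBB i b hb) (hBB i c hc)
            (fun h => hab (hu h)) (fun h => hac (hu h)) (fun h => hbc (hu h))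
        intro L hL
        simp only [List.mem_cons, List.not_mem_nil, or_false] at hL
        rcases hL with rfl | rfl | rfl | rfl
        · exact this 0
        · exact this 1
        · exact this 2
        · exact this 3)
    refine ⟨k, h1, fun i => ?_, fun i => ?_, fun i => not_not.1 (h2 i)⟩
    · exact ((mem_avoid _ _).1 (h3 i)).1
    · have := ((mem_avoid _ _).1 (h3 i)).2
      exact ⟨hBB i _ this.1, hBB i _ this.2.1, hBB i _ this.2.2⟩
  have hEX3 : ∀ x, G.Adj (w 3) x → x = v ∨ (∃ j, u j = x) ∨
      s(w 3, x) ∈ (R 3).image (fun x => s(w 3, x)) := by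
    intro x hx
    by_cases h : x ∈ R 3
    · right; right; exact Finset.mem_image_of_mem _ h
    · rw [← hr, mU]
      rw [mR] at h
      push Not at h
      by_cases hxv : x = v
      · exact Or.inl hxv
      · exact Or.inr (Or.inl ⟨(h hx hxv).1, (h hx hxv).2⟩)
  have hEXi : ∀ i, i ≠ 3 → ∀ x, G.Adj (w i) x → x = v ∨ (∃ j, u j = x) ∨
      s(w i, x) ∈ (R 3).image (fun x => s(w 3, x)) ∨ ∃ j, j ≠ 3 ∧ x = w j := by
    intro i hi x hx
    by_cases h : x ∈ R i
    · obtain ⟨j, rfl⟩ := RW i hi x h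
      by_cases hj : j = 3
      · subst hj
        right; right; left
        rw [Finset.mem_image]
        refine ⟨w i, (mR _ _).2 ⟨hx.symm, (hvw i).ne, fun _ => ⟨i, rfl⟩⟩, Sym2.eq_swap⟩
      · exact Or.inr (Or.inr (Or.inr ⟨j, hj, rfl⟩))
    · rw [← hr, mU]
      rw [mR] at h
      push Not at h
      by_cases hxv : x = v
      · exact Or.inl hxv
      · exact Or.inr (Or.inl ⟨(h hx hxv).1, (h hx hxv).2⟩)
  have hEc : ((R 3).image (fun x => s(w 3, x))).card ≤ 1 := Finset.card_image_le.trans (R1 3)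
  have hvu := fun j => (huU j).1
  rcases hp with hp | hp
  · obtain ⟨k, h1, h2, h3, h4⟩ := S8
    obtain ⟨KX, c1, c2⟩ := kx15 (G := G) v u
    refine red_main hnored w v u hinj hvw hvu k h1 h2 h3 h4 _ KX ?_ c2 0 (by omega) 0 (by omega)
      (show KX.card + ((R 3).image (fun x => s(w 3, x))).card ≤ _ by omega)
    intro i x hx
    by_cases hi : i = 3
    · subst hi; exact hEX3 x hx
    · rcases hEXi i hi x hx with h | h | h | ⟨j, hj, rfl⟩
      · exact Or.inl h
      · exact Or.inr (Or.inl h)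
      · exact Or.inr (Or.inr h)
      · exact absurd hx (hp i j hi hj)
  · have hN : ∀ i x, G.Adj (w i) x → x = v ∨ (∃ j, u j = x) ∨
        s(w i, x) ∈ insert s(w 0, w 1) ((R 3).image (fun x => s(w 3, x))) := by
      intro i x hx
      rw [Finset.mem_insert]
      by_cases hi : i = 3
      · subst hi
        have := hEX3 x hx
        tauto
      · rcases hEXi i hi x hx with h | h | h | ⟨j, hj, rfl⟩
        · exact Or.inl h
        · exact Or.inr (Or.inl h)
        · exact Or.inr (Or.inr (Or.inr h))
        · right; right; left
          have h0 := htri 0 1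
          have h1 := htri 1 0
          by_cases i0 : i = 0
          · subst i0
            rw [h0 j hp hx]
          · by_cases i1 : i = 1
            · subst i1
              rw [← h1 j hp.symm hx]
              exact Sym2.eq_swap
            · exfalso
              by_cases j0 : j = 0
              · subst j0; exact i1 (h0 i hp hx.symm).symm
              · by_cases j1 : j = 1
                · subst j1; exact i0 (h1 i hp.symm hx.symm).symm
                · have : i = j := by omega
                  subst this
                  exact hx.ne rfl
    have hEc2 : (insert s(w 0, w 1) ((R 3).image (fun x => s(w 3, x)))).card ≤ 2 :=
      (Finset.card_insert_le _ _).trans (by omega)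
    by_cases hcomp : ∀ s t, s ≠ t → G.Adj (u s) (u t)
    · obtain ⟨z, z4, zp, k, h1, h3⟩ := sdr9 p p' q q' hqq
      obtain ⟨KX, c1, c2⟩ := kx15 (G := G) v u
      have h3' := fun i => (mem_avoid _ _).1 (h3 i)
      have hL : ∀ i : Fin 4, ∀ j, j ∉ ![[4, z], [p, z], [p'], [q, q']] i →
          G.Adj (w i) (u j) ∧ (i = 0 ∨ i = 1 → z ≠ j) := by
        intro i j hj
        fin_cases i
        · simp at hj
          exact ⟨hB0 j hj.1, fun _ => Ne.symm hj.2⟩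
        · simp at hj
          exact ⟨hB1 j hj.1, fun _ => Ne.symm hj.2⟩
        · simp at hj
          exact ⟨hB2 j hj, by simp⟩
        · simp at hj
          exact ⟨hB3 j hj.1 hj.2, by simp⟩
      refine red_main hnored w v u hinj hvw hvu k h1 (fun i => (h3' i).1)
        (fun i => ⟨(hL i _ (h3' i).2.1).1, (hL i _ (h3' i).2.2.1).1, (hL i _ (h3' i).2.2.2).1⟩)
        (fun i => hcomp _ _ (h3' i).1.1.ne) _ KX hN c2 1 le_rfl z ?_ (by omega)
      intro _
      refine ⟨⟨hp, hB0 z z4, hB1 z zp⟩, fun i hi => ?_⟩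
      exact ⟨(hL i _ (h3' i).2.1).2 hi, (hL i _ (h3' i).2.2.1).2 hi, (hL i _ (h3' i).2.2.2).2 hi⟩
    · push Not at hcomp
      obtain ⟨s, t, hst, hn⟩ := hcomp
      obtain ⟨KX, c1, c2⟩ := kx14 (G := G) v u hu (fun j => (hvu j).ne') s t hst hn
      obtain ⟨k, h1, h2, h3, h4⟩ := S8
      exact red_main hnored w v u hinj hvw hvu k h1 h2 h3 h4 _ KX hN c2 0 (by omega) 0 (by omega)
        (by omega)

lemma main_claim [Finite V] [DecidableEq V] {G : SimpleGraph V} (hrob : Robust G)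
    (hnored : ¬ ∃ V₀ : Finset V, ReducibleVertexSet G V₀) (v : V)
    (hv : (G.neighborSet v).ncard = 9) (a b c d : V) (hnd : [a, b, c, d].Nodup)
    (hlow : ∀ x ∈ [a, b, c, d], (G.neighborSet x).ncard ≤ 6)
    (hvw : ∀ x ∈ [a, b, c, d], G.Adj v x)
    (hsub : ∀ y ∈ [a, b, c], ∀ x, G.Adj y x → x = v ∨ G.Adj v x) : False := by
  have key : ∀ a b c : V, [a, b, c, d].Nodup → (∀ x ∈ [a, b, c, d], (G.neighborSet x).ncard ≤ 6) →
      (∀ x ∈ [a, b, c, d], G.Adj v x) → (∀ y ∈ [a, b, c], ∀ x, G.Adj y x → x = v ∨ G.Adj v x) →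
      (¬ G.Adj a b ∧ ¬ G.Adj a c ∧ ¬ G.Adj b c) ∨ G.Adj a b → False := by
    intro a b c hnd hlow hvw hsub hp
    refine core hrob hnored v hv ![a, b, c, d] ?_ ?_ ?_ ?_ ?_
    · rw [← List.nodup_ofFn]
      simpa [List.ofFn_succ] using hnd
    · intro i
      apply hlow
      fin_cases i <;> simp
    · intro i
      apply SimpleGraph.Adj.symm
      apply hvw
      fin_cases i <;> simp
    · intro i hi
      apply hsub
      fin_cases i <;> simp at hi ⊢
    · rcases hp with ⟨h1, h2, h3⟩ | h
      · left
        intro i j hi hj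
        fin_cases i <;> fin_cases j <;> simp at hi hj ⊢ <;>
          first | assumption | (rw [G.adj_comm]; assumption)
      · right; exact h
  by_cases h1 : G.Adj a b
  · exact key a b c hnd hlow hvw hsub (Or.inr h1)
  by_cases h2 : G.Adj a c
  · refine key a c b ?_ ?_ ?_ ?_ (Or.inr h2)
    · simp at hnd ⊢; grind
    · simp at hlow ⊢; tauto
    · simp at hvw ⊢; tauto
    · simp at hsub ⊢; tauto
  by_cases h3 : G.Adj b c
  · refine key b c a ?_ ?_ ?_ ?_ (Or.inr h3)
    · simp at hnd ⊢; grind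
    · simp at hlow ⊢; tauto
    · simp at hvw ⊢; tauto
    · simp at hsub ⊢; tauto
  exact key a b c hnd hlow hvw hsub (Or.inl ⟨h1, h2, h3⟩)

lemma final [Fintype V] [DecidableEq V] (G : SimpleGraph V) (hrob : Robust G)
    (hnored : ¬ ∃ V₀ : Finset V, ReducibleVertexSet G V₀)
    (v : V) (hv : (G.neighborSet v).ncard = 9) (A : Set V)
    (hA : ∀ w ∈ A, (G.neighborSet w).ncard ≤ 6 ∧
        G.neighborSet w ∪ {w} ⊆ G.neighborSet v ∪ {v}) (x : V) (hx : x ∉ A)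
    (hvx : G.Adj v x) (hlx : (G.neighborSet x).ncard ≤ 6) : A.ncard ≤ 2 := by
  classical
  by_contra hcon
  obtain ⟨B, hBA, hB⟩ := Set.exists_subset_card_eq (s := A) (n := 3) (by omega)
  rw [Set.ncard_eq_toFinset_card'] at hB
  obtain ⟨a, b, c, hnd, hm⟩ := ex3 _ hB
  have hABC : ∀ y ∈ [a, b, c], y ∈ A := by
    intro y hy
    exact hBA (by simpa using (hm y).2 hy)
  have hsub : ∀ y ∈ [a, b, c], ∀ x, G.Adj y x → x = v ∨ G.Adj v x := by
    intro y hy x hx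
    have := (hA y (hABC y hy)).2 (Or.inl hx)
    rcases this with h | h
    · exact Or.inr h
    · exact Or.inl h
  have hadj : ∀ y ∈ [a, b, c], G.Adj v y := by
    intro y hy
    have := (hA y (hABC y hy)).2 (Or.inr rfl)
    rcases this with h | h
    · exact h
    · have h2 := (hA y (hABC y hy)).1
      rw [Set.mem_singleton_iff.1 h, hv] at h2
      omega
  have hlow : ∀ y ∈ [a, b, c], (G.neighborSet y).ncard ≤ 6 := fun y hy => (hA y (hABC y hy)).1
  have hne : ∀ y ∈ [a, b, c], y ≠ x := by
    rintro y hy rfl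
    exact hx (hABC y hy)
  simp only [List.mem_cons, List.not_mem_nil, or_false, forall_eq_or_imp, forall_eq] at hadj hlow hne
  refine main_claim hrob hnored v hv a b c x ?_ ?_ ?_ hsub
  · simp only [List.nodup_cons, List.nodup_nil, List.mem_cons, List.not_mem_nil, or_false,
      not_or] at hnd ⊢
    tauto
  · simp only [List.mem_cons, List.not_mem_nil, or_false, forall_eq_or_imp, forall_eq]
    tauto
  · simp only [List.mem_cons, List.not_mem_nil, or_false, forall_eq_or_imp, forall_eq]
    tauto

end NV

/-- In a robust graph with no reducible vertex set, every vertex of degree 9 subsumes at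
most three vertices of degree at most 6; and if it subsumes exactly three such vertices,
then every neighbor of degree at most 6 is among the subsumed vertices. -/
theorem nine_vertex_subsumes_at_most_three [Fintype V] [DecidableEq V]
    (G : SimpleGraph V) (hrob : Robust G)
    (hnored : ¬ ∃ V₀ : Finset V, ReducibleVertexSet G V₀)
    (v : V) (hv : (G.neighborSet v).ncard = 9) :
    {w | (G.neighborSet w).ncard ≤ 6 ∧
        G.neighborSet w ∪ {w} ⊆ G.neighborSet v ∪ {v}}.ncard ≤ 3 ∧
      ({w | (G.neighborSet w).ncard ≤ 6 ∧
          G.neighborSet w ∪ {w} ⊆ G.neighborSet v ∪ {v}}.ncard = 3 →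
        {x | x ∈ G.neighborSet v ∧ (G.neighborSet x).ncard ≤ 6} ⊆
          {w | (G.neighborSet w).ncard ≤ 6 ∧
            G.neighborSet w ∪ {w} ⊆ G.neighborSet v ∪ {v}}) := by
  set A := {w | (G.neighborSet w).ncard ≤ 6 ∧
        G.neighborSet w ∪ {w} ⊆ G.neighborSet v ∪ {v}} with hAdef
  have hA : ∀ w ∈ A, (G.neighborSet w).ncard ≤ 6 ∧
      G.neighborSet w ∪ {w} ⊆ G.neighborSet v ∪ {v} := fun w hw => hw
  constructor
  · by_contra hcon
    have hne : A.Nonempty := by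
      rw [← Set.ncard_pos]
      omega
    obtain ⟨x, hx⟩ := hne
    have h1 := Set.ncard_sdiff_singleton_add_one hx
    have hvx : G.Adj v x := by
      rcases (hA x hx).2 (Or.inr rfl) with h | h
      · exact h
      · have h2 := (hA x hx).1
        rw [Set.mem_singleton_iff.1 h, hv] at h2
        omega
    have := NV.final G hrob hnored v hv (A \ {x}) (fun w hw => hA w hw.1) x (by simp) hvx (hA x hx).1
    omega
  · intro h3 x hx
    by_contra hxA
    have := NV.final G hrob hnored v hv A hA x hxA hx.1 hx.2
    omega
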